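/- arXiv:2312.17032 — 8 statements merged into one kernel-verified Lean document; each statement's English description precedes it below -/
import Mathlib

section
/- Let F be a finite field and let ρ : GL₂(F) → PGL₂(F) be the canonical projection. If a ∈ PGL₂(F) satisfies a^5 = e, where e is the identity of PGL₂(F), then there exists a matrix M ∈ GL₂(F) with ρ(M) = a and M^5 = E, where E is the identity matrix. -/
/-- The projective general linear group `PGL₂(F)`: the quotient of `GL₂(F)` by its center
(the nonzero scalar matrices). -/
abbrev PGL2 (F : Type*) [Field F] : Type _ :=
  GL (Fin 2) F ⧸ Subgroup.center (GL (Fin 2) F)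

/-- If an element `a` of `PGL₂(F)` over a finite field `F` satisfies `a ^ 5 = 1`, then it
lifts to a matrix `M ∈ GL₂(F)` with `M ^ 5 = 1`. -/
theorem stmt_5 {F : Type*} [Field F] [Finite F] (a : PGL2 F) (ha : a ^ 5 = 1) :
    ∃ M : GL (Fin 2) F,
      QuotientGroup.mk' (Subgroup.center (GL (Fin 2) F)) M = a ∧ M ^ 5 = 1 := by
  obtain ⟨A, rfl⟩ := QuotientGroup.mk_surjective a
  have hA : A ^ 5 ∈ Subgroup.center (GL (Fin 2) F) := by
    rwa [← QuotientGroup.eq_one_iff]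
  rw [Matrix.GeneralLinearGroup.center_eq_range_scalar] at hA
  obtain ⟨c, hc⟩ := hA
  set d := Matrix.GeneralLinearGroup.det A
  have hd : d ^ 5 = c ^ 2 := by
    rw [← map_pow, ← hc, Matrix.GeneralLinearGroup.det_scalar, Fintype.card_fin]
  have hμ : c * (d ^ 2 * c⁻¹) ^ 5 = 1 := by
    calc c * (d ^ 2 * c⁻¹) ^ 5 = (d ^ 5) ^ 2 * (c * (c⁻¹) ^ 5) := by
          rw [mul_pow, ← pow_mul, ← pow_mul, mul_left_comm]
      _ = 1 := by rw [hd]; group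
  have hs : Matrix.GeneralLinearGroup.scalar (Fin 2) (d ^ 2 * c⁻¹) ∈
      Subgroup.center (GL (Fin 2) F) := by
    rw [Matrix.GeneralLinearGroup.center_eq_range_scalar]
    exact ⟨_, rfl⟩
  refine ⟨A * Matrix.GeneralLinearGroup.scalar (Fin 2) (d ^ 2 * c⁻¹), ?_, ?_⟩
  · exact QuotientGroup.mk_mul_of_mem A hs
  · have hcomm : Commute A (Matrix.GeneralLinearGroup.scalar (Fin 2) (d ^ 2 * c⁻¹)) :=
      Subgroup.mem_center_iff.1 hs A
    rw [hcomm.mul_pow, ← hc, ← map_pow, ← map_mul, hμ, map_one]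
end

section
/- Let F be a finite field containing a non-trivial fifth root of unity ξ (ξ^5 = 1, ξ ≠ 1). Then every subgroup G of order 5 in PGL₂(F) is conjugate in PGL₂(F) to the subgroup generated by the image of the diagonal matrix diag(1, ξ). In particular, any two subgroups of order 5 in PGL₂(F) are conjugate. -/
open Polynomial in
/-- A matrix of finite multiplicative order `n` over a field containing a primitive `n`-th root
of unity is scalar or has two different eigenvalues, both of them `n`-th roots of unity. -/
lemma Matrix.exists_ne_det_sub_scalar_eq_zero {m F : Type*} [Fintype m] [DecidableEq m]
    [Nonempty m] [Field F] {n : ℕ} (hn : 0 < n) {ζ : F} (hζ : IsPrimitiveRoot ζ n)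
    (B : Matrix m m F) (hB : B ^ n = 1) (hs : ∀ a : F, B ≠ Matrix.scalar m a) :
    ∃ a b : F, a ^ n = 1 ∧ b ^ n = 1 ∧ a ≠ b ∧
      (B - Matrix.scalar m a).det = 0 ∧ (B - Matrix.scalar m b).det = 0 := by
  classical
  have hfac : ∀ a : F, aeval B (X - C a) = B - Matrix.scalar m a := fun a => by
    rw [map_sub, aeval_X, aeval_C]; rfl
  have hdet : ∀ s : Finset F, (aeval B (∏ a ∈ s, (X - C a))).det =
      ∏ a ∈ s, (B - Matrix.scalar m a).det := fun s => by
    simp only [← hfac]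
    exact map_prod (Matrix.detMonoidHom.comp (aeval B : F[X] →ₐ[F] Matrix m m F).toMonoidHom) _ s
  have hprod : aeval B (∏ a ∈ nthRootsFinset n (1 : F), (X - C a)) = 0 := by
    rw [← X_pow_sub_one_eq_prod hn hζ]
    simp [hB]
  have hzero := hdet (nthRootsFinset n (1 : F))
  rw [hprod, Matrix.det_zero, eq_comm, Finset.prod_eq_zero_iff] at hzero
  obtain ⟨a, ha, hda⟩ := hzero
  have hrest := hdet ((nthRootsFinset n (1 : F)).erase a)
  rw [← Finset.mul_prod_erase _ _ ha, map_mul, hfac] at hprod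
  have hsing : (aeval B (∏ b ∈ (nthRootsFinset n (1 : F)).erase a, (X - C b))).det = 0 := by
    by_contra hne
    have hunit := (Matrix.isUnit_iff_isUnit_det _).2 (isUnit_iff_ne_zero.2 hne)
    exact hs a (sub_eq_zero.1 (hunit.mul_left_eq_zero.1 hprod))
  rw [hsing, eq_comm, Finset.prod_eq_zero_iff] at hrest
  obtain ⟨b, hb, hdb⟩ := hrest
  rw [Finset.mem_erase] at hb
  exact ⟨a, b, (mem_nthRootsFinset hn _).1 ha, (mem_nthRootsFinset hn _).1 hb.2, hb.1.symm,
    hda, hdb⟩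

/-- A `2 × 2` matrix with two different eigenvalues is diagonalizable. -/
lemma Matrix.exists_mul_eq_mul_diagonal {F : Type*} [Field F] (B : Matrix (Fin 2) (Fin 2) F)
    {a b : F} (hab : a ≠ b) (ha : (B - Matrix.scalar (Fin 2) a).det = 0)
    (hb : (B - Matrix.scalar (Fin 2) b).det = 0) :
    ∃ P : GL (Fin 2) F, B * (P : Matrix (Fin 2) (Fin 2) F) = P * Matrix.diagonal ![a, b] := by
  obtain ⟨v, hv, hBv⟩ := Matrix.exists_mulVec_eq_zero_iff.2 ha
  obtain ⟨w, hw, hBw⟩ := Matrix.exists_mulVec_eq_zero_iff.2 hb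
  have eigen : ∀ {u : Fin 2 → F} {c : F}, (B - Matrix.scalar (Fin 2) c).mulVec u = 0 →
      ∀ i, B i 0 * u 0 + B i 1 * u 1 = c * u i := fun {u c} h i => by
    have := congrFun h i
    fin_cases i <;> simp [Matrix.mulVec, dotProduct, Fin.sum_univ_two] at this ⊢ <;>
      linear_combination this
  have ev := eigen hBv
  have ew := eigen hBw
  have hdet : (!![v 0, w 0; v 1, w 1] : Matrix (Fin 2) (Fin 2) F).det ≠ 0 := fun h => by
    obtain ⟨u, hu, hPu⟩ := Matrix.exists_mulVec_eq_zero_iff.2 h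
    have h0 : v 0 * u 0 + w 0 * u 1 = 0 := by
      simpa [Matrix.mulVec, dotProduct, Fin.sum_univ_two] using congrFun hPu 0
    have h1 : v 1 * u 0 + w 1 * u 1 = 0 := by
      simpa [Matrix.mulVec, dotProduct, Fin.sum_univ_two] using congrFun hPu 1
    have hv' : ∀ i, u 0 * v i = 0 := fun i => by
      refine (mul_eq_zero.1 (?_ : (a - b) * (u 0 * v i) = 0)).resolve_left (sub_ne_zero.2 hab)
      have hi : v i * u 0 + w i * u 1 = 0 := by fin_cases i <;> assumption
      linear_combination -u 0 * ev i - u 1 * ew i + B i 0 * h0 + B i 1 * h1 - b * hi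
    have hw' : ∀ i, u 1 * w i = 0 := fun i => by
      have hi : v i * u 0 + w i * u 1 = 0 := by fin_cases i <;> assumption
      linear_combination hi - hv' i
    have hu0 : u 0 = 0 := by
      by_contra hne
      exact hv (funext fun i => (mul_eq_zero.1 (hv' i)).resolve_left hne)
    have hu1 : u 1 = 0 := by
      by_contra hne
      exact hw (funext fun i => (mul_eq_zero.1 (hw' i)).resolve_left hne)
    exact hu (funext fun i => by fin_cases i <;> assumption)
  refine ⟨Matrix.GeneralLinearGroup.mkOfDetNeZero _ hdet, ?_⟩
  ext i j
  have evi := ev i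
  have ewi := ew i
  fin_cases i <;> fin_cases j <;>
    simp [Matrix.GeneralLinearGroup.mkOfDetNeZero, Matrix.mul_apply, Fin.sum_univ_two]
      at evi ewi ⊢ <;>
    first | linear_combination evi | linear_combination ewi

/-- For odd `n`, an element of `GL₂(F)` whose `n`-th power is central is, up to a central factor,
of order dividing `n`. -/
lemma Matrix.GeneralLinearGroup.exists_scalar_mul_pow_eq_one {F : Type*} [Field F] {n : ℕ}
    (hn : Odd n) (A : GL (Fin 2) F) (hA : A ^ n ∈ Subgroup.center (GL (Fin 2) F)) :
    ∃ c : Fˣ, (Matrix.GeneralLinearGroup.scalar (Fin 2) c * A) ^ n = 1 := by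
  rw [Matrix.GeneralLinearGroup.center_eq_range_scalar] at hA
  obtain ⟨l, hl⟩ := hA
  obtain ⟨k, rfl⟩ := hn
  have hdet : l ^ 2 = Matrix.GeneralLinearGroup.det A ^ (2 * k + 1) := by
    rw [← map_pow, ← hl, Matrix.GeneralLinearGroup.det_scalar, Fintype.card_fin]
  set d := Matrix.GeneralLinearGroup.det A
  refine ⟨d ^ k * l⁻¹, ?_⟩
  rw [Commute.mul_pow (Matrix.GeneralLinearGroup.scalar_commute _ A), ← hl, ← map_pow, ← map_mul]
  convert map_one (Matrix.GeneralLinearGroup.scalar (Fin 2))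
  have : (d ^ k * l⁻¹) ^ (2 * k + 1) * l = (d ^ (2 * k + 1)) ^ k * (l ^ 2)⁻¹ ^ k := by
    rw [mul_pow, pow_succ l⁻¹, mul_assoc, inv_mul_cancel_right]
    simp only [← pow_mul, inv_pow]
    ring_nf
  rw [this, ← hdet, inv_pow, mul_inv_cancel]

/-- If a finite field `F` contains a non-trivial fifth root of unity `ξ`, then every
subgroup of order `5` of `PGL₂(F)` is conjugate to the subgroup generated by the image
of the diagonal matrix `diag(1, ξ)`. -/
theorem stmt_6 {F : Type*} [Field F] [Finite F] (ξ : F) (hξ5 : ξ ^ 5 = 1) (hξ1 : ξ ≠ 1)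
    (G : Subgroup (PGL2 F)) (hG : Nat.card G = 5) :
    ∃ D : GL (Fin 2) F, (D : Matrix (Fin 2) (Fin 2) F) = Matrix.diagonal ![1, ξ] ∧
      ∃ c : PGL2 F,
        Subgroup.map (MulAut.conj c).toMonoidHom G =
          Subgroup.zpowers (QuotientGroup.mk' (Subgroup.center (GL (Fin 2) F)) D) := by
  have hξ : IsPrimitiveRoot ξ 5 := by
    have := Fact.mk Nat.prime_five
    exact IsPrimitiveRoot.iff_orderOf.2 (orderOf_eq_prime hξ5 hξ1)
  have hξ0 : ξ ≠ 0 := hξ.ne_zero (by norm_num)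
  have hdetD : (Matrix.diagonal ![1, ξ] : Matrix (Fin 2) (Fin 2) F).det ≠ 0 := by
    simpa [Matrix.det_diagonal] using hξ0
  let D : GL (Fin 2) F := Matrix.GeneralLinearGroup.mkOfDetNeZero _ hdetD
  have hD : (D : Matrix (Fin 2) (Fin 2) F) = Matrix.diagonal ![1, ξ] := rfl
  have hDpow : ∀ k, ((D ^ k : GL (Fin 2) F) : Matrix (Fin 2) (Fin 2) F) =
      Matrix.diagonal ![1, ξ ^ k] := fun k => by
    rw [Units.val_pow_eq_pow_val, hD, Matrix.diagonal_pow]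
    congr 1
    ext i
    fin_cases i <;> simp
  refine ⟨D, hD, ?_⟩
  set π := QuotientGroup.mk' (Subgroup.center (GL (Fin 2) F))
  have hπ : ∀ {A : GL (Fin 2) F}, π A = 1 ↔ A ∈ Subgroup.center (GL (Fin 2) F) :=
    fun {A} => QuotientGroup.eq_one_iff A
  have hscalar : ∀ c : Fˣ, π (Matrix.GeneralLinearGroup.scalar (Fin 2) c) = 1 := fun c => by
    rw [hπ, Matrix.GeneralLinearGroup.center_eq_range_scalar]
    exact ⟨c, rfl⟩
  have hD5 : π D ^ 5 = 1 := by
    rw [← map_pow]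
    convert map_one π
    ext i j
    rw [hDpow, hξ5]
    fin_cases i <;> fin_cases j <;> simp
  have : Nontrivial G := Finite.one_lt_card_iff_nontrivial.1 (by rw [hG]; norm_num)
  obtain ⟨⟨g, hgG⟩, hg1⟩ := exists_ne (1 : G)
  have hg1 : g ≠ 1 := fun h => hg1 (Subtype.ext h)
  have hg5 : g ^ 5 = 1 := by
    simpa [hG] using congrArg Subtype.val (pow_card_eq_one' (x := (⟨g, hgG⟩ : G)))
  have hord : orderOf g = 5 :=
    have := Fact.mk Nat.prime_five
    orderOf_eq_prime hg5 hg1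
  have hGg : Subgroup.zpowers g = G :=
    have := Nat.finite_of_card_ne_zero (hG ▸ (by norm_num) : Nat.card G ≠ 0)
    Subgroup.eq_of_le_of_card_ge (Subgroup.zpowers_le.2 hgG) (by rw [Nat.card_zpowers, hord, hG])
  obtain ⟨A, rfl⟩ := QuotientGroup.mk'_surjective _ g
  obtain ⟨c, hc⟩ := A.exists_scalar_mul_pow_eq_one (n := 5) (by decide)
    (hπ.1 (by rw [map_pow]; exact hg5))
  set B := Matrix.GeneralLinearGroup.scalar (Fin 2) c * A
  have hBA : π B = π A := by rw [map_mul, hscalar, one_mul]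
  obtain ⟨a, b, ha5, hb5, hab, hda, hdb⟩ :=
    Matrix.exists_ne_det_sub_scalar_eq_zero (by norm_num) hξ (B : Matrix (Fin 2) (Fin 2) F)
      (by rw [← Units.val_pow_eq_pow_val, hc, Units.val_one]) (fun a h => hg1 (by
        rw [← hBA, hπ, Matrix.GeneralLinearGroup.mem_center_iff_val_mem_range_scalar]
        exact ⟨a, h.symm⟩))
  obtain ⟨P, hP⟩ := Matrix.exists_mul_eq_mul_diagonal _ hab hda hdb
  have ha0 : a ≠ 0 := fun h => by simp [h] at ha5
  obtain ⟨k, -, hk⟩ := hξ.eq_pow_of_pow_eq_one (ξ := b / a) (by rw [div_pow, ha5, hb5, div_one])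
  have hBP : B * P = P * (Matrix.GeneralLinearGroup.scalar (Fin 2) (Units.mk0 a ha0) * D ^ k) := by
    refine Units.ext ?_
    rw [Units.val_mul, hP, Units.val_mul, Units.val_mul, hDpow, hk]
    congr 1
    ext i j
    fin_cases i <;> fin_cases j <;> simp [mul_div_cancel₀, ha0]
  have hconj : (π P)⁻¹ * π A * π P = π D ^ k := by
    rw [← hBA, mul_assoc, ← map_mul, hBP, map_mul, map_mul, hscalar, one_mul, map_pow,
      inv_mul_cancel_left]
  have hfin : IsOfFinOrder (π D) := isOfFinOrder_iff_pow_eq_one.2 ⟨5, by norm_num, hD5⟩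
  have : Finite (Subgroup.zpowers (π D)) := hfin.finite_zpowers
  refine ⟨(π P)⁻¹, Subgroup.eq_of_le_of_card_ge ?_ ?_⟩
  · rw [← hGg, MonoidHom.map_zpowers, Subgroup.zpowers_le]
    have : MulAut.conj (π P)⁻¹ (π A) = π D ^ k := by rw [MulAut.conj_apply, inv_inv, hconj]
    exact this ▸ Subgroup.npow_mem_zpowers _ k
  · rw [Nat.card_zpowers, Subgroup.card_map_of_injective (MulAut.conj _).injective, hG]
    exact Nat.le_of_dvd (by norm_num) (orderOf_dvd_of_pow_eq_one hD5)
end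

section
/- Let k be a positive integer and let F be the finite field with 4^k elements, and assume that F does not contain a non-trivial fifth root of unity (equivalently, k is odd). Let α ∈ F be an element with α² + α + 1 = 0 (such α exists since F₄ ⊆ F; one has α = ξ + ξ^4 for a non-trivial fifth root of unity ξ in the algebraic closure of F). Then every subgroup G of order 5 in PGL₂(F) is conjugate in PGL₂(F) to the subgroup generated by the image of the matrix [[α, 1], [1, 0]]. In particular, any two subgroups of order 5 in PGL₂(F) are conjugate. -/
open Matrix

theorem mem_center_GL2_iff {F : Type*} [Field F] (A : GL (Fin 2) F) :
    A ∈ Subgroup.center (GL (Fin 2) F) ↔ A 0 1 = 0 ∧ A 1 0 = 0 ∧ A 0 0 = A 1 1 := by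
  rw [Matrix.GeneralLinearGroup.center_eq_range_scalar]
  constructor
  · rintro ⟨u, rfl⟩
    simp [GeneralLinearGroup.scalar]
  · rintro ⟨h01, h10, h⟩
    have hdet : A.val.det ≠ 0 := A.isUnit.map Matrix.detMonoidHom |>.ne_zero
    have h0 : A 0 0 ≠ 0 := by
      intro h0
      rw [Matrix.det_fin_two] at hdet
      simp_all
    refine ⟨Units.mk0 _ h0, ?_⟩
    ext i j
    fin_cases i <;> fin_cases j <;> simp_all

/-- A non-scalar `2 × 2` matrix is conjugate to the companion matrix of its characteristic
polynomial. -/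
theorem exists_mul_eq_mul_companion {F : Type*} [Field F] (A : Matrix (Fin 2) (Fin 2) F)
    (hA : ¬ (A 0 1 = 0 ∧ A 1 0 = 0 ∧ A 0 0 = A 1 1)) :
    ∃ P : GL (Fin 2) F, A * P.val = P.val * !![A.trace, 1; -A.det, 0] := by
  have key : ∀ x y : F, (A 0 0 * x + A 0 1 * y) * y - x * (A 1 0 * x + A 1 1 * y) ≠ 0 →
      ∃ P : GL (Fin 2) F, A * P.val = P.val * !![A.trace, 1; -A.det, 0] := by
    intro x y h
    refine ⟨GeneralLinearGroup.mkOfDetNeZero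
      !![A 0 0 * x + A 0 1 * y, x; A 1 0 * x + A 1 1 * y, y] ?_, ?_⟩
    · rwa [Matrix.det_fin_two_of]
    · have hdet := Matrix.det_fin_two A
      have htr := Matrix.trace_fin_two A
      ext i j
      fin_cases i <;> fin_cases j <;>
        simp [GeneralLinearGroup.mkOfDetNeZero, Matrix.mul_apply, Fin.sum_univ_two, hdet, htr] <;> ring
  by_contra hne
  refine hA ?_
  have h01 : A 0 1 = 0 := by
    by_contra h
    exact hne (key 0 1 (by simpa using h))
  have h10 : A 1 0 = 0 := by
    by_contra h
    exact hne (key 1 0 (by simpa using h))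
  refine ⟨h01, h10, ?_⟩
  by_contra h
  exact hne (key 1 1 (by simpa [h01, h10, sub_eq_zero] using h))

theorem exists_det_one_lift {F : Type*} [Field F] [CharP F 2] [Finite F] (g : PGL2 F) :
    ∃ A : GL (Fin 2) F, A.val.det = 1 ∧ QuotientGroup.mk' (Subgroup.center _) A = g := by
  obtain ⟨B, rfl⟩ := QuotientGroup.mk'_surjective _ g
  have hB : B.val.det ≠ 0 := B.isUnit.map Matrix.detMonoidHom |>.ne_zero
  obtain ⟨s, hs⟩ := FiniteField.isSquare_of_char_two (F := F) (ringChar.eq F 2) B.val.det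
  have hs0 : s ≠ 0 := by
    rintro rfl
    simp_all
  let u := GeneralLinearGroup.scalar (Fin 2) (Units.mk0 s⁻¹ (inv_ne_zero hs0))
  have hu : u ∈ Subgroup.center (GL (Fin 2) F) := by
    rw [Matrix.GeneralLinearGroup.center_eq_range_scalar]
    exact ⟨_, rfl⟩
  refine ⟨u * B, ?_, ?_⟩
  · have : u.val = Matrix.scalar (Fin 2) s⁻¹ := rfl
    rw [Units.val_mul, Matrix.det_mul, this, hs]
    simp
    field_simp
  · have hu1 : QuotientGroup.mk' (Subgroup.center (GL (Fin 2) F)) u = 1 :=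
      (QuotientGroup.eq_one_iff u).mpr hu
    rw [map_mul, hu1, one_mul]

theorem pow_five_of_det_one {F : Type*} [Field F] [CharP F 2] (A : Matrix (Fin 2) (Fin 2) F)
    (hA : A.det = 1) :
    A ^ 5 = (A.trace ^ 2 + A.trace + 1) ^ 2 • A + A.trace ^ 3 • (1 : Matrix (Fin 2) (Fin 2) F) := by
  have h2 : A ^ 2 = A.trace • A + 1 := by
    rw [Matrix.det_fin_two, CharTwo.sub_eq_add] at hA
    rw [Matrix.trace_fin_two, pow_two]
    have := CharTwo.two_eq_zero (R := F)
    ext i j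
    fin_cases i <;> fin_cases j <;>
      simp [Matrix.mul_apply, Fin.sum_univ_two, ← hA] <;> grind
  generalize A.trace = t at *
  have e : A ^ 5 = A ^ 2 * A ^ 2 * A := by noncomm_ring
  have h3 : A * A = t • A + 1 := by rw [← pow_two, h2]
  have := CharTwo.two_eq_zero (R := F)
  rw [e, h2]
  simp only [add_mul, mul_add, smul_mul_assoc, mul_smul_comm, one_mul, mul_one, h3, smul_add,
    smul_smul]
  match_scalars <;> grind

theorem trace_of_pow_five_mem_center {F : Type*} [Field F] [CharP F 2] (A : GL (Fin 2) F)
    (hdet : A.val.det = 1) (hA : A ∉ Subgroup.center (GL (Fin 2) F))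
    (h5 : A ^ 5 ∈ Subgroup.center (GL (Fin 2) F)) :
    A.val.trace ^ 2 + A.val.trace + 1 = 0 := by
  by_contra hne
  rw [mem_center_GL2_iff] at hA h5
  rw [Units.val_pow_eq_pow_val, pow_five_of_det_one _ hdet] at h5
  exact hA (by simpa [hne] using h5)

theorem exists_conj_eq {F : Type*} [Field F] [CharP F 2] [Finite F] (α : F)
    (hα : α ^ 2 + α + 1 = 0) (M : GL (Fin 2) F) (hM : M.val = !![α, 1; 1, 0])
    (g : PGL2 F) (hg : g ≠ 1) (hg5 : g ^ 5 = 1) :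
    ∃ n : ℕ, ∃ c : PGL2 F, c * g ^ n * c⁻¹ = QuotientGroup.mk' (Subgroup.center _) M := by
  have of_trace : ∀ (A : GL (Fin 2) F), A.val.det = 1 → A.val.trace = α →
      A ∉ Subgroup.center (GL (Fin 2) F) → ∃ c : PGL2 F,
        c * QuotientGroup.mk' (Subgroup.center _) A * c⁻¹ =
          QuotientGroup.mk' (Subgroup.center _) M := by
    intro A hdet htr hA
    rw [mem_center_GL2_iff] at hA
    obtain ⟨P, hP⟩ := exists_mul_eq_mul_companion A.val hA
    rw [hdet, htr, CharTwo.neg_eq, ← hM] at hP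
    have hP' : A * P = P * M := Units.ext hP
    refine ⟨QuotientGroup.mk' _ P⁻¹, ?_⟩
    rw [← map_inv, ← map_mul, ← map_mul, inv_inv, mul_assoc, hP', inv_mul_cancel_left]
  obtain ⟨A, hdet, rfl⟩ := exists_det_one_lift g
  have hmem : ∀ B : GL (Fin 2) F, QuotientGroup.mk' (Subgroup.center _) B = 1 ↔
      B ∈ Subgroup.center (GL (Fin 2) F) := fun B => QuotientGroup.eq_one_iff B
  have htr := trace_of_pow_five_mem_center A hdet (by rwa [← hmem])
    (by rwa [← hmem, map_pow])
  have h2 := CharTwo.two_eq_zero (R := F)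
  have hcases : (A.val.trace - α) * (A.val.trace - (α + 1)) = 0 := by grind
  rcases mul_eq_zero.mp hcases with h | h
  · exact ⟨1, by simpa using of_trace A hdet (sub_eq_zero.mp h) (by rwa [← hmem])⟩
  · refine ⟨2, ?_⟩
    rw [← map_pow]
    refine of_trace _ (by simp [hdet]) ?_ ?_
    · have hsq : (A.val ^ 2).trace = A.val.trace ^ 2 := by
        rw [Matrix.trace_fin_two, Matrix.trace_fin_two, pow_two]
        rw [Matrix.det_fin_two] at hdet
        simp only [Matrix.mul_apply, Fin.sum_univ_two]
        grind
      rw [Units.val_pow_eq_pow_val, hsq]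
      grind
    · rw [← hmem, map_pow]
      intro hsq
      refine hg ?_
      rwa [show 5 = 2 * 2 + 1 by norm_num, pow_succ, pow_mul, hsq, one_pow, one_mul] at hg5

/-- Let `F` be the field with `4 ^ k` elements, containing no non-trivial fifth root of
unity, and let `α ∈ F` satisfy `α² + α + 1 = 0`. Then every subgroup of order `5` of
`PGL₂(F)` is conjugate to the subgroup generated by the image of the matrix
`[[α, 1], [1, 0]]`. -/
theorem stmt_7 (k : ℕ) (hk : 0 < k)
    (hroot : ¬ ∃ ξ : GaloisField 2 (2 * k), ξ ^ 5 = 1 ∧ ξ ≠ 1)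
    (α : GaloisField 2 (2 * k)) (hα : α ^ 2 + α + 1 = 0)
    (G : Subgroup (PGL2 (GaloisField 2 (2 * k)))) (hG : Nat.card G = 5) :
    ∃ M : GL (Fin 2) (GaloisField 2 (2 * k)),
      (M : Matrix (Fin 2) (Fin 2) (GaloisField 2 (2 * k))) = !![α, 1; 1, 0] ∧
      ∃ c : PGL2 (GaloisField 2 (2 * k)),
        Subgroup.map (MulAut.conj c).toMonoidHom G =
          Subgroup.zpowers
            (QuotientGroup.mk' (Subgroup.center (GL (Fin 2) (GaloisField 2 (2 * k)))) M) := by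
  have : Fact (Nat.Prime 5) := ⟨by norm_num⟩
  have : Finite G := Nat.finite_of_card_ne_zero (by omega)
  have : Nontrivial G := Finite.one_lt_card_iff_nontrivial.mp (by omega)
  let M : GL (Fin 2) (GaloisField 2 (2 * k)) :=
    GeneralLinearGroup.mkOfDetNeZero !![α, 1; 1, 0] (by simp [Matrix.det_fin_two_of])
  have hM : M.val = !![α, 1; 1, 0] := rfl
  refine ⟨M, hM, ?_⟩
  obtain ⟨g, hg⟩ := exists_ne (1 : G)
  have hg5 : g ^ 5 = 1 := hG ▸ pow_card_eq_one'
  obtain ⟨n, c, hc⟩ := exists_conj_eq α hα M hM g.val (by simpa using hg)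
    (by exact_mod_cast congrArg Subtype.val hg5)
  refine ⟨c, ?_⟩
  have hgn : g ^ n ≠ 1 := by
    intro h
    have h' : (g : PGL2 (GaloisField 2 (2 * k))) ^ n = 1 := by
      exact_mod_cast congrArg Subtype.val h
    rw [h', mul_one, mul_inv_cancel] at hc
    have hmem := (mem_center_GL2_iff M).mp ((QuotientGroup.eq_one_iff M).mp hc.symm)
    rw [hM] at hmem
    simp at hmem
  have hG' : G = Subgroup.zpowers ((g : PGL2 (GaloisField 2 (2 * k))) ^ n) := by
    have htop := zpowers_eq_top_of_prime_card hG hgn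
    have := congrArg (Subgroup.map G.subtype) htop
    rw [MonoidHom.map_zpowers, ← MonoidHom.range_eq_map, Subgroup.range_subtype] at this
    simpa using this.symm
  rw [hG', MonoidHom.map_zpowers, ← hc]
  rfl
end

section
/- In the Weyl group W(E₆), the centralizer of any element of order 5 is a cyclic group of order 10 (isomorphic to ℤ/10ℤ). -/
/-- The Weyl group of type `E₆`, presented as the Coxeter group of the `E₆` Coxeter
matrix. -/
abbrev WE6 : Type _ := CoxeterMatrix.E₆.Group

/-! ### Rewriting of words in a Coxeter group -/

namespace CoxeterMatrix

variable {B : Type*} [DecidableEq B] (M : CoxeterMatrix B)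

/-- Remove a letter `s` from a word, provided that it can be moved to the front by commutation
relations. -/
def pullFront (s : B) : List B → Option (List B)
  | [] => none
  | t :: w =>
    if s = t then some w
    else if M s t = 2 then (pullFront s w).map (t :: ·)
    else none

/-- Equality of words up to commutation relations. -/
def commEquiv : List B → List B → Bool
  | [], v => v.isEmpty
  | s :: u, v => match M.pullFront s v with
    | none => false
    | some v' => commEquiv u v'

/-- Move a letter `s` from the left of a word to its right by commutation and braid relations;
the value is the letter that comes out on the right. The first argument bounds the number of
steps. -/
def pushThrough : ℕ → B → List B → Option B
  | 0, _, _ => none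
  | _ + 1, s, [] => some s
  | n + 1, s, t :: w =>
    if M s t = 2 then pushThrough n s w
    else if M s t = 3 then match M.pullFront s w with
      | none => none
      | some w' => pushThrough n t w'
    else none

/-- The words `R` represent the left cosets of the parabolic subgroup generated by `K` in the one
generated by `J`, as verified by commutation and braid relations. -/
def CosetWords (J K : List B) (R : List (List B)) : Prop :=
  [] ∈ R ∧ ∀ s ∈ J, ∀ w ∈ R,
    (∃ w' ∈ R, M.commEquiv (s :: w) w' = true ∨ M.commEquiv w (s :: w') = true) ∨
      ∃ t ∈ K, M.pushThrough (w.length + 1) s w = some t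

instance (J K : List B) (R : List (List B)) : Decidable (M.CosetWords J K R) := by
  unfold CosetWords; infer_instance

end CoxeterMatrix

namespace CoxeterSystem

variable {B W : Type*} [Group W] {M : CoxeterMatrix B} (cs : CoxeterSystem M W)

theorem simple_mul_comm_of_eq_two {i j : B} (h : M i j = 2) :
    cs.simple i * cs.simple j = cs.simple j * cs.simple i := by
  have := cs.simple_mul_simple_pow i j
  rw [h, pow_two] at this
  rw [eq_inv_of_mul_eq_one_left this]
  simp

theorem simple_mul_braid_of_eq_three {i j : B} (h : M i j = 3) :
    cs.simple i * cs.simple j * cs.simple i = cs.simple j * cs.simple i * cs.simple j := by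
  have := cs.simple_mul_simple_pow i j
  rw [h, pow_succ, pow_two] at this
  have h' : (cs.simple i * cs.simple j * cs.simple i) *
      (cs.simple j * cs.simple i * cs.simple j) = 1 := by
    rw [← this]; group
  rw [eq_inv_of_mul_eq_one_left h']
  simp [mul_assoc]

variable [DecidableEq B]

theorem wordProd_of_pullFront {s : B} {w w' : List B} (h : M.pullFront s w = some w') :
    cs.wordProd w = cs.simple s * cs.wordProd w' := by
  induction w generalizing w' with
  | nil => simp [CoxeterMatrix.pullFront] at h
  | cons t w ih =>
    rw [CoxeterMatrix.pullFront] at h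
    split_ifs at h with h1 h2
    · cases h
      rw [h1, wordProd_cons]
    · obtain ⟨u, hu, rfl⟩ := Option.map_eq_some_iff.1 h
      rw [wordProd_cons, wordProd_cons, ih hu, ← mul_assoc, ← mul_assoc,
        cs.simple_mul_comm_of_eq_two h2]

theorem wordProd_eq_of_commEquiv {u v : List B} (h : M.commEquiv u v = true) :
    cs.wordProd u = cs.wordProd v := by
  induction u generalizing v with
  | nil =>
    rw [CoxeterMatrix.commEquiv, List.isEmpty_iff] at h
    rw [h]
  | cons s u ih =>
    rw [CoxeterMatrix.commEquiv] at h
    split at h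
    · cases h
    · rename_i v' hv
      rw [wordProd_cons, ih h, cs.wordProd_of_pullFront hv]

theorem simple_mul_wordProd_of_pushThrough {n : ℕ} {s t : B} {w : List B}
    (h : M.pushThrough n s w = some t) :
    cs.simple s * cs.wordProd w = cs.wordProd w * cs.simple t := by
  induction n generalizing s w with
  | zero => simp [CoxeterMatrix.pushThrough] at h
  | succ n ih =>
    cases w with
    | nil =>
      rw [CoxeterMatrix.pushThrough, Option.some_inj] at h
      simp [h]
    | cons a w =>
      rw [CoxeterMatrix.pushThrough] at h
      split_ifs at h with h1 h2
      · rw [wordProd_cons, ← mul_assoc, cs.simple_mul_comm_of_eq_two h1, mul_assoc, ih h,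
          mul_assoc]
      · split at h
        · cases h
        · rename_i w' hw
          rw [wordProd_cons, cs.wordProd_of_pullFront hw, mul_assoc, mul_assoc, ← ih h,
            ← mul_assoc, ← mul_assoc, cs.simple_mul_braid_of_eq_three h2, mul_assoc, mul_assoc]

/-- The parabolic subgroup generated by the simple reflections in a list. -/
def parabolic (J : List B) : Subgroup W := Subgroup.closure (cs.simple '' {j | j ∈ J})

omit [DecidableEq B] in
theorem simple_mem_parabolic {J : List B} {j : B} (h : j ∈ J) : cs.simple j ∈ cs.parabolic J :=
  Subgroup.subset_closure ⟨j, h, rfl⟩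

theorem exists_eq_wordProd_mul {J K : List B} {R : List (List B)} (hR : M.CosetWords J K R)
    {g : W} (hg : g ∈ cs.parabolic J) :
    ∃ w ∈ R, ∃ h ∈ cs.parabolic K, g = cs.wordProd w * h := by
  have step : ∀ s ∈ J, ∀ y : W, (∃ w ∈ R, ∃ h ∈ cs.parabolic K, y = cs.wordProd w * h) →
      ∃ w ∈ R, ∃ h ∈ cs.parabolic K, cs.simple s * y = cs.wordProd w * h := by
    rintro s hs _ ⟨w, hw, h, hh, rfl⟩
    rcases hR.2 s hs w hw with ⟨w', hw', e | e⟩ | ⟨t, ht, e⟩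
    · refine ⟨w', hw', h, hh, ?_⟩
      rw [← cs.wordProd_eq_of_commEquiv e, wordProd_cons, mul_assoc]
    · refine ⟨w', hw', h, hh, ?_⟩
      rw [cs.wordProd_eq_of_commEquiv e, wordProd_cons, mul_assoc, simple_mul_simple_cancel_left]
    · refine ⟨w, hw, cs.simple t * h, mul_mem (cs.simple_mem_parabolic ht) hh, ?_⟩
      rw [← mul_assoc, cs.simple_mul_wordProd_of_pushThrough e, mul_assoc]
  induction hg using Subgroup.closure_induction_left with
  | one => exact ⟨[], hR.1, 1, one_mem _, by simp⟩
  | mul_left x hx y _ ih =>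
    obtain ⟨s, hs, rfl⟩ := hx
    exact step s hs y ih
  | inv_mul_cancel x hx y _ ih =>
    obtain ⟨s, hs, rfl⟩ := hx
    rw [inv_simple]
    exact step s hs y ih

end CoxeterSystem

/-! ### The reflection representation of `W(E₆)` modulo two -/

namespace WE6

open Matrix

/-- The Coxeter system of `W(E₆)`. -/
abbrev coxeterSystem : CoxeterSystem CoxeterMatrix.E₆ WE6 := CoxeterMatrix.E₆.toCoxeterSystem

/-- The simple reflections modulo two, in the basis of simple roots. -/
def reflection (i : Fin 6) : Matrix (Fin 6) (Fin 6) (ZMod 2) :=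
  Matrix.of fun j k => if j = k then 1 else if j = i ∧ CoxeterMatrix.E₆ i k = 3 then 1 else 0

theorem isLiftable_reflection : CoxeterMatrix.E₆.IsLiftable reflection := by
  unfold CoxeterMatrix.IsLiftable
  decide +kernel

/-- The reflection representation of `W(E₆)` modulo two. -/
def rep : WE6 →* Matrix (Fin 6) (Fin 6) (ZMod 2) :=
  coxeterSystem.lift ⟨reflection, isLiftable_reflection⟩

theorem rep_simple (i : Fin 6) : rep (coxeterSystem.simple i) = reflection i :=
  coxeterSystem.lift_apply_simple isLiftable_reflection i

theorem rep_wordProd_mulVec (w : List (Fin 6)) (v : Fin 6 → ZMod 2) :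
    rep (coxeterSystem.wordProd w) *ᵥ v = w.foldr (fun i u => reflection i *ᵥ u) v := by
  induction w with
  | nil => simp
  | cons i w ih => rw [CoxeterSystem.wordProd_cons, map_mul, rep_simple, ← mulVec_mulVec, ih]; rfl

theorem rep_mulVec_of_mem_parabolic {K : List (Fin 6)} {v : Fin 6 → ZMod 2}
    (hv : ∀ i ∈ K, reflection i *ᵥ v = v) {h : WE6} (hh : h ∈ coxeterSystem.parabolic K) :
    rep h *ᵥ v = v := by
  induction hh using Subgroup.closure_induction_left with
  | one => simp
  | mul_left x hx y _ ih =>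
    obtain ⟨s, hs, rfl⟩ := hx
    rw [map_mul, ← mulVec_mulVec, ih, rep_simple, hv s hs]
  | inv_mul_cancel x hx y _ ih =>
    obtain ⟨s, hs, rfl⟩ := hx
    rw [CoxeterSystem.inv_simple, map_mul, ← mulVec_mulVec, ih, rep_simple, hv s hs]

/-- Faithfulness of the representation passes from the parabolic subgroup generated by `K` to the
one generated by `J` if some vector is fixed by the former, but not by any nontrivial coset
representative. -/
theorem faithful_step {J K : List (Fin 6)} (R : List (List (Fin 6))) (v : Fin 6 → ZMod 2)
    (hR : CoxeterMatrix.E₆.CosetWords J K R) (hK : ∀ i ∈ K, reflection i *ᵥ v = v)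
    (hv : ∀ w ∈ R, w.foldr (fun i u => reflection i *ᵥ u) v = v → w = [])
    (ih : ∀ g ∈ coxeterSystem.parabolic K, rep g = 1 → g = 1) :
    ∀ g ∈ coxeterSystem.parabolic J, rep g = 1 → g = 1 := by
  intro g hg h1
  obtain ⟨w, hw, h, hh, rfl⟩ := coxeterSystem.exists_eq_wordProd_mul hR hg
  have : w = [] := by
    apply hv w hw
    rw [← rep_wordProd_mulVec]
    nth_rewrite 1 [← rep_mulVec_of_mem_parabolic hK hh]
    rw [mulVec_mulVec, ← map_mul, h1, one_mulVec]
  subst this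
  rw [CoxeterSystem.wordProd_nil, one_mul] at h1 ⊢
  exact ih h hh h1

theorem rep_injective : Function.Injective rep := by
  rw [injective_iff_map_eq_one]
  have h0 : ∀ g ∈ coxeterSystem.parabolic [], rep g = 1 → g = 1 := by
    intro g hg _
    simpa [CoxeterSystem.parabolic] using hg
  have h1 := faithful_step (J := [0]) [[], [0]] ![0, 0, 1, 0, 0, 0]
    (by decide +kernel) (by decide +kernel) (by decide +kernel) h0
  have h2 := faithful_step (J := [0, 2]) [[], [2], [0, 2]] ![0, 0, 0, 1, 0, 0]
    (by decide +kernel) (by decide +kernel) (by decide +kernel) h1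
  have h3 := faithful_step (J := [0, 2, 3]) [[], [3], [2, 3], [0, 2, 3]] ![0, 0, 0, 0, 1, 0]
    (by decide +kernel) (by decide +kernel) (by decide +kernel) h2
  have h4 := faithful_step (J := [0, 2, 3, 4]) [[], [4], [3, 4], [2, 3, 4], [0, 2, 3, 4]]
    ![0, 0, 0, 0, 0, 1] (by decide +kernel) (by decide +kernel) (by decide +kernel) h3
  have h5 := faithful_step (J := [0, 2, 3, 4, 1])
    [[], [1], [3, 1], [2, 3, 1], [4, 3, 1], [0, 2, 3, 1], [4, 2, 3, 1], [4, 0, 2, 3, 1],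
      [3, 4, 2, 3, 1], [3, 4, 0, 2, 3, 1], [1, 3, 4, 2, 3, 1], [2, 3, 4, 0, 2, 3, 1],
      [1, 3, 4, 0, 2, 3, 1], [1, 2, 3, 4, 0, 2, 3, 1], [3, 1, 2, 3, 4, 0, 2, 3, 1],
      [4, 3, 1, 2, 3, 4, 0, 2, 3, 1]]
    ![1, 0, 0, 1, 0, 1] (by decide +kernel) (by decide +kernel) (by decide +kernel) h4
  have h6 := faithful_step (J := [0, 2, 3, 4, 1, 5])
    [[], [5], [4, 5], [3, 4, 5], [2, 3, 4, 5], [1, 3, 4, 5], [0, 2, 3, 4, 5], [1, 2, 3, 4, 5],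
      [1, 0, 2, 3, 4, 5], [3, 1, 2, 3, 4, 5], [3, 1, 0, 2, 3, 4, 5], [4, 3, 1, 2, 3, 4, 5],
      [2, 3, 1, 0, 2, 3, 4, 5], [4, 3, 1, 0, 2, 3, 4, 5], [5, 4, 3, 1, 2, 3, 4, 5],
      [4, 2, 3, 1, 0, 2, 3, 4, 5], [5, 4, 3, 1, 0, 2, 3, 4, 5], [3, 4, 2, 3, 1, 0, 2, 3, 4, 5],
      [5, 4, 2, 3, 1, 0, 2, 3, 4, 5], [1, 3, 4, 2, 3, 1, 0, 2, 3, 4, 5],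
      [5, 3, 4, 2, 3, 1, 0, 2, 3, 4, 5], [5, 1, 3, 4, 2, 3, 1, 0, 2, 3, 4, 5],
      [4, 5, 3, 4, 2, 3, 1, 0, 2, 3, 4, 5], [4, 5, 1, 3, 4, 2, 3, 1, 0, 2, 3, 4, 5],
      [3, 4, 5, 1, 3, 4, 2, 3, 1, 0, 2, 3, 4, 5],
      [2, 3, 4, 5, 1, 3, 4, 2, 3, 1, 0, 2, 3, 4, 5],
      [0, 2, 3, 4, 5, 1, 3, 4, 2, 3, 1, 0, 2, 3, 4, 5]]
    ![0, 1, 0, 0, 1, 0] (by decide +kernel) (by decide +kernel) (by decide +kernel) h5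
  have htop : coxeterSystem.parabolic [0, 2, 3, 4, 1, 5] = ⊤ := by
    rw [CoxeterSystem.parabolic, ← coxeterSystem.subgroup_closure_range_simple,
      ← Set.image_univ]
    congr 2
    ext i
    fin_cases i <;> simp
  intro g
  exact h6 g (htop ▸ Subgroup.mem_top g)

instance : Finite WE6 := Finite.of_injective rep rep_injective

/-- The quadratic form modulo two on the root lattice. -/
def quadForm (v : Fin 6 → ZMod 2) : ZMod 2 :=
  v 0 ^ 2 + v 1 ^ 2 + v 2 ^ 2 + v 3 ^ 2 + v 4 ^ 2 + v 5 ^ 2 +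
    v 0 * v 2 + v 1 * v 3 + v 2 * v 3 + v 3 * v 4 + v 4 * v 5

theorem quadForm_reflection : ∀ (i : Fin 6) (v : Fin 6 → ZMod 2),
    quadForm (reflection i *ᵥ v) = quadForm v := by
  decide +kernel

theorem quadForm_rep (g : WE6) (v : Fin 6 → ZMod 2) : quadForm (rep g *ᵥ v) = quadForm v := by
  induction g using coxeterSystem.simple_induction_left with
  | one => simp
  | mul_simple_left g i ih => rw [map_mul, ← mulVec_mulVec, rep_simple, quadForm_reflection, ih]

/-- The Coxeter element of a parabolic subgroup of type `A₄`. -/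
def coxeterA₄ : WE6 := coxeterSystem.wordProd [0, 2, 3, 1]

/-- The Coxeter element of a parabolic subgroup of type `A₄ × A₁`. -/
def coxeterA₄A₁ : WE6 := coxeterSystem.wordProd [0, 2, 3, 1, 5]

/-- The matrix of `coxeterA₄`. -/
def matrixA₄ : Matrix (Fin 6) (Fin 6) (ZMod 2) :=
  !![0, 1, 0, 0, 1, 0;
     0, 1, 0, 1, 0, 0;
     1, 1, 0, 0, 1, 0;
     0, 1, 1, 0, 1, 0;
     0, 0, 0, 0, 1, 0;
     0, 0, 0, 0, 0, 1]

/-- The matrix of `coxeterA₄A₁`. -/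
def matrixA₄A₁ : Matrix (Fin 6) (Fin 6) (ZMod 2) := matrixA₄ * reflection 5

theorem rep_coxeterA₄ : rep coxeterA₄ = matrixA₄ := by
  simp only [coxeterA₄, CoxeterSystem.wordProd_cons, CoxeterSystem.wordProd_nil, map_mul, map_one,
    rep_simple]
  decide +kernel

theorem rep_coxeterA₄A₁ : rep coxeterA₄A₁ = matrixA₄A₁ := by
  simp only [coxeterA₄A₁, CoxeterSystem.wordProd_cons, CoxeterSystem.wordProd_nil, map_mul,
    map_one, rep_simple]
  decide +kernel

theorem coxeterA₄A₁_pow_six : coxeterA₄A₁ ^ 6 = coxeterA₄ := by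
  apply rep_injective
  rw [map_pow, rep_coxeterA₄A₁, rep_coxeterA₄]
  decide +kernel

theorem orderOf_coxeterA₄A₁ : orderOf coxeterA₄A₁ = 10 := by
  rw [← orderOf_injective rep rep_injective, rep_coxeterA₄A₁]
  refine orderOf_eq_of_pow_and_pow_div_prime (by norm_num) (by decide +kernel) ?_
  intro p hp hd
  have : p ∈ Nat.primeFactors 10 := Nat.mem_primeFactors.2 ⟨hp, hd, by norm_num⟩
  rw [show Nat.primeFactors 10 = {2, 5} by decide +kernel, Finset.mem_insert,
    Finset.mem_singleton] at this
  rcases this with rfl | rfl <;> decide +kernel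

theorem orderOf_coxeterA₄ : orderOf coxeterA₄ = 5 := by
  rw [← coxeterA₄A₁_pow_six, orderOf_pow, orderOf_coxeterA₄A₁]
  norm_num

/-- A matrix commuting with `matrixA₄` is trivial if it fixes generators of the module over
`(ZMod 2)[matrixA₄]`. -/
theorem eq_one_of_commute_matrixA₄ {A : Matrix (Fin 6) (Fin 6) (ZMod 2)}
    (hA : A * matrixA₄ = matrixA₄ * A) (h0 : A *ᵥ Pi.single 0 1 = Pi.single 0 1)
    (h14 : A *ᵥ (Pi.single 1 1 + Pi.single 4 1) = Pi.single 1 1 + Pi.single 4 1)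
    (h5 : A *ᵥ Pi.single 5 1 = Pi.single 5 1) : A = 1 := by
  have step : ∀ u v, matrixA₄ *ᵥ u = v → A *ᵥ u = u → A *ᵥ v = v := by
    rintro u _ rfl hu
    rw [mulVec_mulVec, hA, ← mulVec_mulVec, hu]
  have h2 := step _ (Pi.single 2 1) (by decide +kernel) h0
  have h3 := step _ (Pi.single 3 1) (by decide +kernel) h2
  have h1 := step _ (Pi.single 1 1) (by decide +kernel) h3
  have h4 : A *ᵥ Pi.single 4 1 = Pi.single 4 1 := by
    rwa [mulVec_add, h1, add_right_inj] at h14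
  apply ext_of_mulVec_single
  intro i
  rw [one_mulVec]
  fin_cases i <;> assumption

theorem eq_single_five_of_fixed : ∀ v : Fin 6 → ZMod 2, matrixA₄ *ᵥ v = v → quadForm v = 1 →
    v = Pi.single 5 1 := by
  decide +kernel

theorem exists_pow_mulVec_eq : ∀ a : Fin 6 → ZMod 2,
    (1 + matrixA₄ + matrixA₄ ^ 2 + matrixA₄ ^ 3 + matrixA₄ ^ 4) *ᵥ a = 0 →
    quadForm a = 1 → quadForm (a + matrixA₄ *ᵥ a) = 1 →
    ∀ b : Fin 6 → ZMod 2, matrixA₄ *ᵥ b = b → quadForm b = 0 →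
    quadForm (b + Pi.single 5 1) = 0 →
    ∃ k : Fin 10, (matrixA₄A₁ ^ (k : ℕ)) *ᵥ Pi.single 0 1 = a ∧
      (matrixA₄A₁ ^ (k : ℕ)) *ᵥ (Pi.single 1 1 + Pi.single 4 1) = b := by
  decide +kernel

theorem pow_mulVec_single_five : ∀ k : Fin 10,
    (matrixA₄A₁ ^ (k : ℕ)) *ᵥ Pi.single 5 1 = Pi.single 5 1 := by
  decide +kernel

theorem centralizer_coxeterA₄ :
    Subgroup.centralizer {coxeterA₄} = Subgroup.zpowers coxeterA₄A₁ := by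
  apply le_antisymm
  · intro c hc
    have hcomm : Commute c coxeterA₄ := Subgroup.mem_centralizer_singleton_iff.1 hc
    have hX : Commute (rep c) matrixA₄ := rep_coxeterA₄ ▸ hcomm.map rep
    have hM : ∀ {A}, Commute (rep c) A → ∀ {u v}, A *ᵥ u = v →
        A *ᵥ (rep c *ᵥ u) = rep c *ᵥ v := by
      rintro A hA u _ rfl
      rw [mulVec_mulVec, mulVec_mulVec, hA.eq]
    have h5 : rep c *ᵥ Pi.single 5 1 = Pi.single 5 1 := by
      apply eq_single_five_of_fixed
      · exact hM hX (by decide +kernel)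
      · rw [quadForm_rep]
        decide +kernel
    have hΦ : Commute (rep c) (1 + matrixA₄ + matrixA₄ ^ 2 + matrixA₄ ^ 3 + matrixA₄ ^ 4) :=
      ((((Commute.one_right _).add_right hX).add_right (hX.pow_right 2)).add_right
        (hX.pow_right 3)).add_right (hX.pow_right 4)
    obtain ⟨k, hk0, hk14⟩ := exists_pow_mulVec_eq (rep c *ᵥ Pi.single 0 1)
      ((hM hΦ (v := 0) (by decide +kernel)).trans (mulVec_zero _))
      (by
        rw [quadForm_rep]
        decide +kernel)
      (by
        rw [hM hX rfl, ← mulVec_add, quadForm_rep]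
        decide +kernel)
      (rep c *ᵥ (Pi.single 1 1 + Pi.single 4 1))
      (hM hX (by decide +kernel))
      (by
        rw [quadForm_rep]
        decide +kernel)
      (by
        rw [← h5, ← mulVec_add, quadForm_rep]
        decide +kernel)
    have hfix : ∀ v, (matrixA₄A₁ ^ (k : ℕ)) *ᵥ v = rep c *ᵥ v →
        rep ((coxeterA₄A₁ ^ (k : ℕ))⁻¹ * c) *ᵥ v = v := by
      intro v hv
      rw [map_mul, ← mulVec_mulVec, ← hv, ← rep_coxeterA₄A₁, ← map_pow, mulVec_mulVec, ← map_mul,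
        inv_mul_cancel, map_one, one_mulVec]
    have hy : Commute (coxeterA₄A₁ ^ (k : ℕ)) coxeterA₄ := by
      rw [← coxeterA₄A₁_pow_six]
      exact Commute.pow_pow_self _ _ _
    have h1 : (coxeterA₄A₁ ^ (k : ℕ))⁻¹ * c = 1 := by
      apply rep_injective
      rw [map_one]
      apply eq_one_of_commute_matrixA₄ _ (hfix _ hk0) (hfix _ hk14)
        (hfix _ ((pow_mulVec_single_five k).trans h5.symm))
      rw [← rep_coxeterA₄, ← map_mul, ← map_mul, (hy.inv_left.mul_left hcomm).eq]
    rw [← inv_mul_eq_one.1 h1]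
    exact Subgroup.npow_mem_zpowers _ _
  · rw [Subgroup.zpowers_le, Subgroup.mem_centralizer_singleton_iff, ← coxeterA₄A₁_pow_six]
    exact Commute.self_pow _ _

theorem factorization_card_five : (Nat.card WE6).factorization 5 = 1 := by
  have hdvd : Nat.card WE6 ∣ Nat.card (GL (Fin 6) (ZMod 2)) := by
    refine Subgroup.card_dvd_of_injective rep.toHomUnits fun a b h => rep_injective ?_
    rw [← MonoidHom.coe_toHomUnits, h, MonoidHom.coe_toHomUnits]
  rw [card_GL_field, ZMod.card] at hdvd
  have hne : Nat.card WE6 ≠ 0 := Nat.card_pos.ne'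
  have h5 : 5 ∣ Nat.card WE6 := orderOf_coxeterA₄ ▸ orderOf_dvd_natCard coxeterA₄
  apply le_antisymm
  · by_contra! h
    have h25 := (Nat.prime_five.pow_dvd_iff_le_factorization hne).2 h
    exact absurd (h25.trans hdvd) (by decide +kernel)
  · exact (Nat.prime_five.dvd_iff_one_le_factorization hne).1 h5

end WE6

theorem exists_mem_zpowers_of_orderOf_eq {G : Type*} [Group G] [Finite G] {p : ℕ}
    [Fact p.Prime] (hp : (Nat.card G).factorization p = 1) {g x : G} (hg : orderOf g = p)
    (hx : orderOf x = p) : ∃ w : G, w * g * w⁻¹ ∈ Subgroup.zpowers x := by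
  have hcard : ∀ y : G, orderOf y = p →
      Nat.card (Subgroup.zpowers y) = p ^ (Nat.card G).factorization p := by
    intro y hy
    rw [Nat.card_zpowers, hy, hp, pow_one]
  obtain ⟨w, hw⟩ := MulAction.exists_smul_eq G (Sylow.ofCard _ (hcard g hg))
    (Sylow.ofCard _ (hcard x hx))
  refine ⟨w, ?_⟩
  have h := congrArg (fun P : Sylow p G => (P : Subgroup G)) hw
  simp only [Sylow.coe_subgroup_smul, Sylow.coe_ofCard] at h
  rw [← h]
  exact Subgroup.smul_mem_pointwise_smul _ (MulAut.conj w) _ (Subgroup.mem_zpowers g)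

/-- The centralizer of an element of prime order only depends on the cyclic subgroup it
generates. -/
theorem centralizer_singleton_eq_of_mem_zpowers {G : Type*} [Group G] {p : ℕ} [Fact p.Prime]
    {g x : G} (hg : orderOf g = p) (hx : orderOf x = p) (h : g ∈ Subgroup.zpowers x) :
    Subgroup.centralizer {g} = Subgroup.centralizer {x} := by
  have hfin : Finite (Subgroup.zpowers x) := by
    apply Nat.finite_of_card_ne_zero
    rw [Nat.card_zpowers, hx]
    exact (Fact.out : p.Prime).ne_zero
  have : Subgroup.zpowers g = Subgroup.zpowers x := by
    apply Subgroup.eq_of_le_of_card_ge (Subgroup.zpowers_le.2 h)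
    rw [Nat.card_zpowers, Nat.card_zpowers, hg, hx]
  rw [← Subgroup.centralizer_closure {g}, ← Subgroup.centralizer_closure {x},
    ← Subgroup.zpowers_eq_closure, ← Subgroup.zpowers_eq_closure, this]

/-- The centralizer of an element of order `5` in the Weyl group `W(E₆)` is a cyclic
group of order `10`. -/
theorem stmt_11 (g : WE6) (hg : orderOf g = 5) :
    IsCyclic (Subgroup.centralizer {g}) ∧ Nat.card (Subgroup.centralizer {g}) = 10 := by
  have : Fact (Nat.Prime 5) := ⟨Nat.prime_five⟩
  obtain ⟨w, hw⟩ := exists_mem_zpowers_of_orderOf_eq WE6.factorization_card_five hg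
    WE6.orderOf_coxeterA₄
  have hord : orderOf (w * g * w⁻¹) = 5 := by
    rw [← hg, ← MulAut.conj_apply]
    exact orderOf_injective (MulAut.conj w).toMonoidHom (MulAut.conj w).injective g
  have hC : Subgroup.centralizer {w * g * w⁻¹} = Subgroup.zpowers WE6.coxeterA₄A₁ := by
    rw [centralizer_singleton_eq_of_mem_zpowers hord WE6.orderOf_coxeterA₄ hw,
      WE6.centralizer_coxeterA₄]
  have hmap : (Subgroup.centralizer {g}).map (MulAut.conj w).toMonoidHom =
      Subgroup.zpowers WE6.coxeterA₄A₁ := by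
    rw [← hC]
    ext c
    rw [Subgroup.mem_map_equiv, Subgroup.mem_centralizer_singleton_iff,
      Subgroup.mem_centralizer_singleton_iff, MulAut.conj_symm_apply]
    refine (SemiconjBy.conj_iff (b := w)).symm.trans ?_
    simp [SemiconjBy, mul_assoc]
  let e : Subgroup.centralizer {g} ≃* Subgroup.zpowers WE6.coxeterA₄A₁ :=
    ((Subgroup.centralizer {g}).equivMapOfInjective _ (MulAut.conj w).injective).trans
      (MulEquiv.subgroupCongr hmap)
  refine ⟨e.isCyclic.2 inferInstance, ?_⟩
  rw [Nat.card_congr e.toEquiv, Nat.card_zpowers, WE6.orderOf_coxeterA₄A₁]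
end

section
/- Let g be an element of order 2 in the Weyl group W(E₆) which commutes with some element of order 5 of W(E₆). Then g is a reflection; that is, g is conjugate in W(E₆) to one of the simple generators (the conjugacy class of type A₁). -/
namespace WE6

open CoxeterMatrix MulAction

/-- The action of the simple generators on the 27 lines of a cubic surface, i.e. on the weights of
a minuscule representation of `E₆`. The lines are numbered by increasing depth of the weight. -/
def lineReflection (i : Fin 6) : Fin 27 → Fin 27 :=
  ![![0, 1, 2, 3, 7, 5, 9, 4, 11, 6, 13, 8, 15, 10, 14, 12, 16, 17, 18, 19, 20, 21, 22, 23, 24, 26, 25],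
    ![0, 1, 2, 5, 6, 3, 4, 9, 8, 7, 10, 11, 12, 13, 14, 15, 16, 17, 20, 22, 18, 23, 19, 21, 24, 25, 26],
    ![0, 1, 2, 4, 3, 6, 5, 7, 8, 9, 10, 14, 12, 16, 11, 17, 13, 15, 18, 19, 20, 21, 22, 23, 25, 24, 26],
    ![0, 1, 3, 2, 4, 5, 8, 7, 6, 11, 10, 9, 12, 13, 14, 15, 18, 19, 16, 17, 20, 21, 22, 24, 23, 25, 26],
    ![0, 2, 1, 3, 4, 5, 6, 7, 10, 9, 8, 13, 12, 11, 16, 15, 14, 17, 18, 21, 20, 19, 23, 22, 24, 25, 26],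
    ![1, 0, 2, 3, 4, 5, 6, 7, 8, 9, 12, 11, 10, 15, 14, 13, 17, 16, 19, 18, 22, 21, 20, 23, 24, 25, 26]] i

theorem lineReflection_involutive (i : Fin 6) : Function.Involutive (lineReflection i) := by
  unfold Function.Involutive
  revert i
  decide +kernel

/-- The permutation of the 27 lines induced by a simple generator. -/
def linePerm (i : Fin 6) : Equiv.Perm (Fin 27) :=
  (lineReflection_involutive i).toPerm

theorem linePerm_isLiftable : E₆.IsLiftable linePerm := by
  unfold IsLiftable
  decide +kernel

/-- The permutation representation of `W(E₆)` on the 27 lines. -/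
def permHom : WE6 →* Equiv.Perm (Fin 27) :=
  E₆.toCoxeterSystem.lift ⟨linePerm, linePerm_isLiftable⟩

@[simp]
theorem permHom_simple (i : Fin 6) : permHom (E₆.simple i) = linePerm i :=
  E₆.toCoxeterSystem.lift_apply_simple linePerm_isLiftable i

@[simp]
theorem linePerm_linePerm (i : Fin 6) (a : Fin 27) : linePerm i (linePerm i a) = a :=
  lineReflection_involutive i a

theorem simple_mul_self (i : Fin 6) : E₆.simple i * E₆.simple i = 1 :=
  E₆.toCoxeterSystem.simple_mul_simple_self i

theorem simple_inv (i : Fin 6) : (E₆.simple i)⁻¹ = E₆.simple i :=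
  E₆.toCoxeterSystem.inv_simple i

theorem simple_mul_comm {i j : Fin 6} (h : E₆ i j = 2) :
    E₆.simple i * E₆.simple j = E₆.simple j * E₆.simple i := by
  have hp : (E₆.simple i * E₆.simple j) ^ E₆ i j = 1 :=
    E₆.toCoxeterSystem.simple_mul_simple_pow i j
  rw [h, sq] at hp
  simpa [simple_inv] using eq_inv_of_mul_eq_one_left hp

theorem simple_braid {i j : Fin 6} (h : E₆ i j = 3) :
    E₆.simple i * E₆.simple j * E₆.simple i = E₆.simple j * E₆.simple i * E₆.simple j := by
  have hp : (E₆.simple i * E₆.simple j) ^ E₆ i j = 1 :=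
    E₆.toCoxeterSystem.simple_mul_simple_pow i j
  rw [h, pow_succ, sq] at hp
  have := eq_inv_of_mul_eq_one_left
    (a := E₆.simple i * E₆.simple j * E₆.simple i)
    (b := E₆.simple j * E₆.simple i * E₆.simple j) (by simpa [mul_assoc] using hp)
  simpa [simple_inv, mul_assoc] using this

/-- The standard parabolic subgroup generated by the simple generators in `J`. -/
def parabolic (J : Finset (Fin 6)) : Subgroup WE6 :=
  Subgroup.closure (E₆.simple '' J)

theorem simple_mem_parabolic {J : Finset (Fin 6)} {i : Fin 6} (hi : i ∈ J) :
    E₆.simple i ∈ parabolic J :=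
  Subgroup.subset_closure ⟨i, hi, rfl⟩

theorem parabolic_mono {J K : Finset (Fin 6)} (h : J ⊆ K) : parabolic J ≤ parabolic K :=
  Subgroup.closure_mono (Set.image_mono h)

theorem parabolic_univ : parabolic Finset.univ = ⊤ := by
  have h := E₆.toCoxeterSystem.subgroup_closure_range_simple
  rwa [toCoxeterSystem_simple, ← Set.image_univ, ← Finset.coe_univ] at h

theorem parabolic_empty : parabolic ∅ = ⊥ := by
  simp [parabolic]

/-- The elements of `J` whose generators fix the line `p`. -/
def fixing (J : Finset (Fin 6)) (p : Fin 27) : Finset (Fin 6) :=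
  J.filter fun i => linePerm i p = p

/-- `O` is the orbit of `p` under the parabolic subgroup of `J`, and `p` is its only line of
locally minimal depth. -/
def IsMinusculeOrbit (J : Finset (Fin 6)) (p : Fin 27) (O : Finset (Fin 27)) : Prop :=
  p ∈ O ∧ (∀ a ∈ O, ∀ i ∈ J, linePerm i a ∈ O) ∧ (∀ i ∈ J, p ≤ linePerm i p) ∧
    ∀ a ∈ O, (∀ i ∈ J, a ≤ linePerm i a) → a = p

instance (J : Finset (Fin 6)) (p : Fin 27) (O : Finset (Fin 27)) :
    Decidable (IsMinusculeOrbit J p O) := by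
  unfold IsMinusculeOrbit
  infer_instance

/-- A product of generators in `J` carrying the line of minimal depth in the orbit of `a` to `a`,
obtained by descending along lines of smaller depth. -/
noncomputable def ascent (J : Finset (Fin 6)) (a : Fin 27) : WE6 :=
  open Classical in
  if h : ∃ i ∈ J, linePerm i a < a then
    E₆.simple h.choose * ascent J (linePerm h.choose a)
  else 1
termination_by a
decreasing_by exact h.choose_spec.2

theorem ascent_cases (J : Finset (Fin 6)) (a : Fin 27) :
    ((∀ i ∈ J, a ≤ linePerm i a) ∧ ascent J a = 1) ∨
      ∃ j ∈ J, linePerm j a < a ∧ ascent J a = E₆.simple j * ascent J (linePerm j a) := by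
  by_cases h : ∃ i ∈ J, linePerm i a < a
  · refine Or.inr ⟨h.choose, h.choose_spec.1, h.choose_spec.2, ?_⟩
    rw [ascent, dif_pos h]
  · refine Or.inl ⟨by simpa using h, ?_⟩
    rw [ascent, dif_neg h]

theorem linePerm_local (a : Fin 27) (i j : Fin 6)
    (h : i ≠ j ∧ linePerm j a < a ∧ linePerm i a ≤ a) :
    (E₆ i j = 2 ∧ linePerm i (linePerm j a) ≤ linePerm j a ∧
      linePerm j (linePerm i a) ≤ linePerm i a ∧
      linePerm i (linePerm j a) = linePerm j (linePerm i a)) ∨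
    (E₆ i j = 3 ∧ linePerm i a = a ∧ linePerm i (linePerm j a) < linePerm j a ∧
      linePerm j (linePerm i (linePerm j a)) = linePerm i (linePerm j a)) := by
  revert i j
  refine Prod.forall'.1 ?_
  revert a
  decide +kernel

section MinusculeOrbit

variable {J : Finset (Fin 6)} {p : Fin 27} {O : Finset (Fin 27)}

theorem ascent_eq_one (hO : IsMinusculeOrbit J p O) : ascent J p = 1 := by
  rcases ascent_cases J p with h | ⟨j, hj, hlt, -⟩
  · exact h.2
  · exact absurd hlt (hO.2.2.1 j hj).not_gt

theorem ascent_mem_and_permHom (hO : IsMinusculeOrbit J p O) {a : Fin 27} (ha : a ∈ O) :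
    ascent J a ∈ parabolic J ∧ permHom (ascent J a) p = a := by
  induction a using WellFoundedLT.induction with
  | ind a ih =>
    rcases ascent_cases J a with ⟨h, h1⟩ | ⟨j, hj, hlt, h1⟩
    · rw [h1, hO.2.2.2 a ha h]
      exact ⟨one_mem _, by simp⟩
    · obtain ⟨hm, hp⟩ := ih _ hlt (hO.2.1 a ha j hj)
      rw [h1]
      exact ⟨mul_mem (simple_mem_parabolic hj) hm, by simp [hp]⟩

theorem simple_smul_ascent_of_le (hO : IsMinusculeOrbit J p O) {a : Fin 27} (ha : a ∈ O)
    {i : Fin 6} (hi : i ∈ J) (hle : linePerm i a ≤ a) :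
    E₆.simple i • (ascent J a : WE6 ⧸ parabolic (fixing J p)) = ascent J (linePerm i a) := by
  induction a using WellFoundedLT.induction generalizing i with
  | ind a ih =>
    rcases ascent_cases J a with ⟨h, h1⟩ | ⟨j, hj, hlt, h1⟩
    · obtain rfl := hO.2.2.2 a ha h
      have hfix : linePerm i a = a := le_antisymm hle (h i hi)
      rw [hfix, h1, MulAction.Quotient.smul_coe, smul_eq_mul, mul_one, QuotientGroup.eq]
      exact mul_mem (inv_mem <| simple_mem_parabolic <| Finset.mem_filter.2 ⟨hi, hfix⟩) (one_mem _)
    · have hx : (ascent J a : WE6 ⧸ parabolic (fixing J p)) =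
          E₆.simple j • (ascent J (linePerm j a) : WE6 ⧸ parabolic (fixing J p)) := by
        rw [h1]; rfl
      have hb := hO.2.1 a ha j hj
      by_cases hij : i = j
      · subst hij
        rw [hx, smul_smul, simple_mul_self, one_smul]
      rcases linePerm_local a i j ⟨hij, hlt, hle⟩ with ⟨hM, hib, hji, hc⟩ | ⟨hM, hia, hib, hc⟩
      · rw [hx, smul_smul, simple_mul_comm hM, mul_smul, ih _ hlt hb hi hib]
        rcases hle.lt_or_eq with hlt' | heq
        · rw [hc, ← ih _ hlt' (hO.2.1 a ha i hi) hj hji, smul_smul, simple_mul_self, one_smul]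
        · rw [hc, heq, hx]
      · have hcO := hO.2.1 _ hb i hi
        have hx' := ih _ hlt hb hi hib.le
        have hxc := ih _ (hib.trans hlt) hcO hj hc.le
        rw [hc] at hxc
        have hxb := inv_smul_eq_iff.2 hx'.symm
        rw [simple_inv] at hxb
        rw [hia, hx, ← hxb]
        nth_rewrite 2 [← hxc]
        simp only [smul_smul, ← mul_assoc, simple_braid hM]

theorem simple_smul_ascent (hO : IsMinusculeOrbit J p O) {a : Fin 27} (ha : a ∈ O)
    {i : Fin 6} (hi : i ∈ J) :
    E₆.simple i • (ascent J a : WE6 ⧸ parabolic (fixing J p)) = ascent J (linePerm i a) := by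
  rcases le_total (linePerm i a) a with h | h
  · exact simple_smul_ascent_of_le hO ha hi h
  · have := simple_smul_ascent_of_le hO (hO.2.1 a ha i hi) hi (by simpa using h)
    rw [linePerm_linePerm] at this
    rw [← this, smul_smul, simple_mul_self, one_smul]

theorem smul_ascent (hO : IsMinusculeOrbit J p O) {w : WE6} (hw : w ∈ parabolic J) :
    ∀ a ∈ O, permHom w a ∈ O ∧
      w • (ascent J a : WE6 ⧸ parabolic (fixing J p)) = ascent J (permHom w a) := by
  induction hw using Subgroup.closure_induction_left with
  | one => simp
  | mul_left x hx y _ ih =>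
    obtain ⟨i, hi, rfl⟩ := hx
    intro a ha
    obtain ⟨hy, hya⟩ := ih a ha
    rw [map_mul, permHom_simple, Equiv.Perm.mul_apply, mul_smul, hya]
    exact ⟨hO.2.1 _ hy i hi, simple_smul_ascent hO hy hi⟩
  | inv_mul_cancel x hx y _ ih =>
    obtain ⟨i, hi, rfl⟩ := hx
    intro a ha
    obtain ⟨hy, hya⟩ := ih a ha
    rw [simple_inv, map_mul, permHom_simple, Equiv.Perm.mul_apply, mul_smul, hya]
    exact ⟨hO.2.1 _ hy i hi, simple_smul_ascent hO hy hi⟩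

theorem mem_parabolic_fixing_iff (hO : IsMinusculeOrbit J p O) {w : WE6} (hw : w ∈ parabolic J) :
    w ∈ parabolic (fixing J p) ↔ permHom w p = p := by
  constructor
  · intro h
    induction h using Subgroup.closure_induction with
    | mem x hx =>
      obtain ⟨i, hi, rfl⟩ := hx
      simpa using (Finset.mem_filter.1 hi).2
    | one => simp
    | mul x y hx hy ihx ihy =>
      have hle := parabolic_mono (Finset.filter_subset (fun i => linePerm i p = p) J)
      rw [map_mul, Equiv.Perm.mul_apply, ihy (hle hy), ihx (hle hx)]
    | inv x hx ih =>
      have hle := parabolic_mono (Finset.filter_subset (fun i => linePerm i p = p) J)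
      rw [map_inv, Equiv.Perm.inv_eq_iff_eq, ih (hle hx)]
  · intro h
    have := (smul_ascent hO hw p hO.1).2
    rw [h, ascent_eq_one hO, MulAction.Quotient.smul_coe, smul_eq_mul, mul_one, eq_comm,
      QuotientGroup.eq] at this
    simpa using this

theorem card_parabolic (hO : IsMinusculeOrbit J p O) :
    Nat.card (parabolic J) = Nat.card (parabolic (fixing J p)) * O.card := by
  let _ : MulAction (parabolic J) (Fin 27) :=
    MulAction.compHom _ (permHom.comp (parabolic J).subtype)
  have hsmul (w : parabolic J) (a : Fin 27) : w • a = permHom w a := rfl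
  have hstab : stabilizer (parabolic J) p = (parabolic (fixing J p)).subgroupOf (parabolic J) := by
    ext w
    rw [mem_stabilizer_iff, hsmul, Subgroup.mem_subgroupOf, mem_parabolic_fixing_iff hO w.2]
  have horb : orbit (parabolic J) p = O := by
    ext a
    constructor
    · rintro ⟨w, rfl⟩
      exact (smul_ascent hO w.2 p hO.1).1
    · intro ha
      obtain ⟨hm, hp⟩ := ascent_mem_and_permHom hO ha
      exact ⟨⟨_, hm⟩, hp⟩
  rw [← Subgroup.card_mul_index (stabilizer (parabolic J) p), index_stabilizer, horb,
    Set.ncard_coe_finset, hstab]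
  congr 1
  exact Nat.card_congr
    (Subgroup.subgroupOfEquivOfLe (parabolic_mono (Finset.filter_subset _ _))).toEquiv

end MinusculeOrbit

theorem isMinusculeOrbit_E6 : IsMinusculeOrbit Finset.univ 0 Finset.univ := by
  decide +kernel

theorem isMinusculeOrbit_D5 :
    IsMinusculeOrbit {0, 1, 2, 3, 4} 1 {1, 2, 3, 4, 5, 6, 7, 8, 9, 10, 11, 13, 14, 16, 18, 20} := by
  decide +kernel

theorem isMinusculeOrbit_A4 :
    IsMinusculeOrbit {0, 1, 2, 3} 2 {2, 3, 4, 5, 6, 7, 8, 9, 11, 14} := by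
  decide +kernel

theorem isMinusculeOrbit_A2_A1 : IsMinusculeOrbit {0, 1, 2} 3 {3, 4, 5, 6, 7, 9} := by
  decide +kernel

theorem isMinusculeOrbit_A1 : IsMinusculeOrbit {0} 4 {4, 7} := by
  decide +kernel

theorem fixing_E6 : fixing Finset.univ 0 = {0, 1, 2, 3, 4} := by decide +kernel

theorem fixing_D5 : fixing {0, 1, 2, 3, 4} 1 = {0, 1, 2, 3} := by decide +kernel

theorem fixing_A4 : fixing {0, 1, 2, 3} 2 = {0, 1, 2} := by decide +kernel

theorem fixing_A2_A1 : fixing {0, 1, 2} 3 = {0} := by decide +kernel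

theorem fixing_A1 : fixing {0} 4 = ∅ := by decide +kernel

theorem card_eq : Nat.card WE6 = 51840 := by
  rw [← Subgroup.card_top, ← parabolic_univ, card_parabolic isMinusculeOrbit_E6, fixing_E6,
    card_parabolic isMinusculeOrbit_D5, fixing_D5, card_parabolic isMinusculeOrbit_A4, fixing_A4,
    card_parabolic isMinusculeOrbit_A2_A1, fixing_A2_A1, card_parabolic isMinusculeOrbit_A1,
    fixing_A1, parabolic_empty, Subgroup.card_bot]
  decide +kernel

/-- Five pairwise skew lines form a base of the permutation representation. -/
theorem eq_one_of_permHom_eq {w : WE6} (h : ∀ a : Fin 27, a < 5 → permHom w a = a) : w = 1 := by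
  have h0 : w ∈ parabolic Finset.univ := parabolic_univ ▸ Subgroup.mem_top w
  have h1 := (mem_parabolic_fixing_iff isMinusculeOrbit_E6 h0).2 (h 0 (by decide))
  rw [fixing_E6] at h1
  have h2 := (mem_parabolic_fixing_iff isMinusculeOrbit_D5 h1).2 (h 1 (by decide))
  rw [fixing_D5] at h2
  have h3 := (mem_parabolic_fixing_iff isMinusculeOrbit_A4 h2).2 (h 2 (by decide))
  rw [fixing_A4] at h3
  have h4 := (mem_parabolic_fixing_iff isMinusculeOrbit_A2_A1 h3).2 (h 3 (by decide))
  rw [fixing_A2_A1] at h4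
  have h5 := (mem_parabolic_fixing_iff isMinusculeOrbit_A1 h4).2 (h 4 (by decide))
  rw [fixing_A1, parabolic_empty] at h5
  exact Subgroup.mem_bot.1 h5

theorem permHom_injective : Function.Injective permHom :=
  (injective_iff_map_eq_one permHom).2 fun w hw => eq_one_of_permHom_eq fun a _ => by simp [hw]

/-- The incidence relation of the 27 lines; each line is given by the binary encoding of the set of
lines meeting it. -/
def meets (a b : Fin 27) : Bool :=
  Nat.testBit (![
    132812800, 129311744, 123488512, 114508352, 97561120, 103760016, 86812808, 63968608, 77832836,
    53220632, 72010370, 44242004, 68512385, 38424914, 27309100, 34948433, 21535018, 18099497,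
    12751462, 9512549, 2789534, 5262179, 2434205, 805275, 213719, 43695, 5503] a) b

theorem meets_permHom (w : WE6) (a b : Fin 27) : meets (permHom w a) (permHom w b) = meets a b := by
  have key : ∀ i a b, meets (linePerm i a) (linePerm i b) = meets a b := by decide +kernel
  induction w using E₆.toCoxeterSystem.simple_induction_left with
  | one => simp
  | mul_simple_left w i ih =>
    rw [toCoxeterSystem_simple, map_mul, permHom_simple, Equiv.Perm.mul_apply,
      Equiv.Perm.mul_apply, key, ih]

/-- An element of order `5`: a Coxeter element of a parabolic subgroup of type `A₄`. -/
def fiveCycle : WE6 :=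
  E₆.simple 2 * E₆.simple 3 * E₆.simple 4 * E₆.simple 5

/-- A word `u` such that `u s₀ u⁻¹` is the reflection in the highest root. -/
def highestWord : WE6 :=
  E₆.simple 1 * E₆.simple 3 * E₆.simple 4 * E₆.simple 5 * E₆.simple 2 * E₆.simple 3 *
    E₆.simple 4 * E₆.simple 1 * E₆.simple 3 * E₆.simple 2

/-- The reflection in the highest root, which commutes with `fiveCycle`. -/
def highestReflection : WE6 :=
  highestWord * E₆.simple 0 * highestWord⁻¹

theorem highestReflection_sq : highestReflection ^ 2 = 1 := by
  rw [highestReflection, conj_pow, sq, simple_mul_self, mul_one, mul_inv_cancel]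

theorem permHom_fiveCycle :
    permHom fiveCycle = linePerm 2 * linePerm 3 * linePerm 4 * linePerm 5 := by
  simp [fiveCycle]

theorem permHom_highestReflection : permHom highestReflection =
    (linePerm 1 * linePerm 3 * linePerm 4 * linePerm 5 * linePerm 2 * linePerm 3 * linePerm 4 *
      linePerm 1 * linePerm 3 * linePerm 2) * linePerm 0 *
    (linePerm 1 * linePerm 3 * linePerm 4 * linePerm 5 * linePerm 2 * linePerm 3 * linePerm 4 *
      linePerm 1 * linePerm 3 * linePerm 2)⁻¹ := by
  simp [highestReflection, highestWord]

theorem fiveCycle_pow : fiveCycle ^ 5 = 1 := by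
  apply permHom_injective
  rw [map_pow, permHom_fiveCycle, map_one]
  decide +kernel

theorem fiveCycle_ne_one : fiveCycle ≠ 1 := by
  intro h
  have := permHom_fiveCycle
  rw [h, map_one] at this
  revert this
  decide +kernel

theorem orderOf_fiveCycle : orderOf fiveCycle = 5 :=
  have : Fact (Nat.Prime 5) := ⟨by norm_num⟩
  orderOf_eq_prime fiveCycle_pow fiveCycle_ne_one

theorem commute_highestReflection_fiveCycle : Commute highestReflection fiveCycle := by
  apply permHom_injective
  rw [map_mul, map_mul, permHom_fiveCycle, permHom_highestReflection]
  decide +kernel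

/-- An element commuting with `fiveCycle` and fixing the line `0` is trivial, because the orbit of
`0` under `fiveCycle` is a base. -/
theorem eq_one_of_commute_fiveCycle {w : WE6} (hc : Commute w fiveCycle)
    (h0 : permHom w 0 = 0) : w = 1 := by
  have key : ∀ a : Fin 27, a < 5 → ∃ k : Fin 5,
      ((linePerm 2 * linePerm 3 * linePerm 4 * linePerm 5) ^ (k : ℕ)) 0 = a := by
    decide +kernel
  refine eq_one_of_permHom_eq fun a ha => ?_
  obtain ⟨k, hk⟩ := key a ha
  rw [← permHom_fiveCycle, ← map_pow] at hk
  rw [← hk, ← Equiv.Perm.mul_apply, ← map_mul, (hc.pow_right k).eq, map_mul,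
    Equiv.Perm.mul_apply, h0]

theorem permHom_apply_zero_of_commute_fiveCycle {w : WE6} (hc : Commute w fiveCycle) :
    ∃ k : Fin 5, permHom w 0 = permHom (fiveCycle ^ (k : ℕ)) 0 ∨
      permHom w 0 = permHom (fiveCycle ^ (k : ℕ) * highestReflection) 0 := by
  have hfix : ∀ a, (linePerm 2 * linePerm 3 * linePerm 4 * linePerm 5) a = a ↔ a = 7 ∨ a = 26 := by
    decide +kernel
  have horb : ∀ a, meets a 7 ≠ meets a 26 → ∃ k : Fin 5,
      a = ((linePerm 2 * linePerm 3 * linePerm 4 * linePerm 5) ^ (k : ℕ)) 0 ∨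
      a = ((linePerm 2 * linePerm 3 * linePerm 4 * linePerm 5) ^ (k : ℕ)) 20 := by
    decide +kernel
  have h20 : permHom highestReflection 0 = 20 := by
    rw [permHom_highestReflection]
    decide +kernel
  rw [← permHom_fiveCycle] at hfix horb
  have hmove (a : Fin 27) (ha : permHom fiveCycle a = a) :
      permHom fiveCycle (permHom w a) = permHom w a := by
    rw [← Equiv.Perm.mul_apply, ← map_mul, ← hc.eq, map_mul, Equiv.Perm.mul_apply, ha]
  have h7 := (hfix _).1 (hmove 7 ((hfix 7).2 (Or.inl rfl)))
  have h26 := (hfix _).1 (hmove 26 ((hfix 26).2 (Or.inr rfl)))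
  have hne : permHom w 7 ≠ permHom w 26 := by simp
  have m7 := meets_permHom w 0 7
  have m26 := meets_permHom w 0 26
  have e : meets 0 7 ≠ meets 0 26 := by decide
  simp only [map_mul, map_pow, Equiv.Perm.mul_apply, h20]
  apply horb
  rcases h7 with h7 | h7 <;> rcases h26 with h26 | h26
  · exact absurd (h7.trans h26.symm) hne
  · rwa [← m7, ← m26, h7, h26] at e
  · rw [← m7, ← m26, h7, h26] at e
    exact e.symm
  · exact absurd (h7.trans h26.symm) hne

theorem eq_highestReflection_of_commute_fiveCycle {g : WE6} (hg : orderOf g = 2)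
    (hc : Commute g fiveCycle) : g = highestReflection := by
  have hg2 : g ^ 2 = 1 := hg ▸ pow_orderOf_eq_one g
  have hcz (k : ℕ) : Commute (fiveCycle ^ k) fiveCycle := (Commute.refl _).pow_left k
  obtain ⟨k, hk | hk⟩ := permHom_apply_zero_of_commute_fiveCycle hc
  · have hk' : g = fiveCycle ^ (k : ℕ) := by
      refine (inv_mul_eq_one.1 <| eq_one_of_commute_fiveCycle
        ((hcz k).inv_left.mul_left hc) ?_).symm
      rw [map_mul, Equiv.Perm.mul_apply, hk, ← Equiv.Perm.mul_apply, ← map_mul, inv_mul_cancel,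
        map_one, Equiv.Perm.one_apply]
    have h5 : g ^ 5 = 1 := by
      rw [hk', ← pow_mul, mul_comm, pow_mul, fiveCycle_pow, one_pow]
    have : orderOf g ∣ 5 := orderOf_dvd_of_pow_eq_one h5
    rw [hg] at this
    omega
  · have hk' : g = fiveCycle ^ (k : ℕ) * highestReflection := by
      refine (inv_mul_eq_one.1 <| eq_one_of_commute_fiveCycle
        (((hcz k).mul_left commute_highestReflection_fiveCycle).inv_left.mul_left hc) ?_).symm
      rw [map_mul, Equiv.Perm.mul_apply, hk, ← Equiv.Perm.mul_apply, ← map_mul, inv_mul_cancel,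
        map_one, Equiv.Perm.one_apply]
    have h2 : fiveCycle ^ ((k : ℕ) * 2) = 1 := by
      rw [hk', (commute_highestReflection_fiveCycle.symm.pow_left k).mul_pow,
        highestReflection_sq, mul_one, ← pow_mul] at hg2
      exact hg2
    have h5 := orderOf_dvd_of_pow_eq_one h2
    rw [orderOf_fiveCycle] at h5
    have hk0 : (k : ℕ) = 0 := by omega
    rw [hk', hk0, pow_zero, one_mul]

/-- All subgroups of order `5` of `W(E₆)` are conjugate, being Sylow subgroups. -/
theorem exists_conj_mem_zpowers {h c : WE6} (hh : orderOf h = 5) (hc : orderOf c = 5) :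
    ∃ w : WE6, w * c * w⁻¹ ∈ Subgroup.zpowers h := by
  have : Fact (Nat.Prime 5) := ⟨by norm_num⟩
  have : Finite WE6 := Nat.finite_of_card_ne_zero (by rw [card_eq]; norm_num)
  have hfac : (Nat.card WE6).factorization 5 = 1 := by
    rw [card_eq, show 51840 = 5 * 10368 by norm_num,
      Nat.factorization_mul (by norm_num) (by norm_num)]
    simp [Nat.factorization_eq_zero_of_not_dvd, (by norm_num : Nat.Prime 5).factorization]
  have hcard {x : WE6} (hx : orderOf x = 5) :
      Nat.card (Subgroup.zpowers x) = 5 ^ (Nat.card WE6).factorization 5 := by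
    rw [Nat.card_zpowers, hx, hfac, pow_one]
  obtain ⟨w, hw⟩ := MulAction.exists_smul_eq WE6 (Sylow.ofCard _ (hcard hc))
    (Sylow.ofCard _ (hcard hh))
  refine ⟨w, ?_⟩
  have hmem : w * c * w⁻¹ ∈ ((w • Sylow.ofCard _ (hcard hc) : Sylow 5 WE6) : Subgroup WE6) := by
    rw [Sylow.coe_subgroup_smul]
    exact Subgroup.smul_mem_pointwise_smul c (MulAut.conj w) _ (Subgroup.mem_zpowers c)
  rwa [hw] at hmem

end WE6

/-- If an element of order `2` of the Weyl group `W(E₆)` commutes with some element of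
order `5`, then it is a reflection, i.e. conjugate to a simple generator. -/
theorem stmt_13 (g h : WE6) (hg : orderOf g = 2) (hh : orderOf h = 5)
    (hc : Commute g h) :
    ∃ i : Fin 6, IsConj (CoxeterMatrix.E₆.simple i) g := by
  obtain ⟨w, hw⟩ := WE6.exists_conj_mem_zpowers hh WE6.orderOf_fiveCycle
  obtain ⟨n, hn⟩ := Subgroup.mem_zpowers_iff.1 hw
  have hcw : Commute g (w * WE6.fiveCycle * w⁻¹) := hn ▸ hc.zpow_right n
  have hcomm : Commute (w⁻¹ * g * w) WE6.fiveCycle := by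
    have := hcw.map (MulAut.conj w⁻¹).toMonoidHom
    simpa [mul_assoc] using this
  have hord : orderOf (w⁻¹ * g * w) = 2 := by
    have := (MulAut.conj w⁻¹).orderOf_eq g
    simpa [hg] using this
  have hr := WE6.eq_highestReflection_of_commute_fiveCycle hord hcomm
  refine ⟨0, isConj_iff.2 ⟨w * WE6.highestWord, ?_⟩⟩
  calc _ = w * WE6.highestReflection * w⁻¹ := by simp [WE6.highestReflection, mul_assoc]
    _ = g := by simp [← hr, mul_assoc]
end

section
/- Any two subgroups of the Weyl group W(E₆) that are isomorphic to the alternating group 𝔄₆ on six letters are conjugate in W(E₆). In other words, the subgroup of W(E₆) isomorphic to 𝔄₆ is unique up to conjugation. -/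
/-- Numerical data certifying that the orbit `O` of `x₀` under the subgroup generated by the
involutions `s j`, `j ∈ J`, looks like the orbit of a minuscule weight whose stabilizer is the
standard parabolic subgroup of type `K`. The function `d` is the depth of a point below `x₀`. -/
structure IsMinusculeOrbit {W X I : Type*} [Group W] [MulAction W X] (s : I → W)
    (adj : I → I → Prop) (J K : Set I) (O : Set X) (d : X → ℕ) (x₀ : X) : Prop where
  subset : K ⊆ J
  base_mem : x₀ ∈ O
  smul_mem : ∀ x ∈ O, ∀ i ∈ J, s i • x ∈ O
  depth_base : d x₀ = 0
  eq_base : ∀ x ∈ O, d x = 0 → x = x₀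
  smul_base : ∀ i ∈ J, s i • x₀ = x₀ ↔ i ∈ K
  exists_descent : ∀ x ∈ O, d x ≠ 0 → ∃ i ∈ J, d (s i • x) + 1 = d x
  depth_smul : ∀ x ∈ O, ∀ i ∈ J,
    s i • x = x ∨ d (s i • x) = d x + 1 ∨ d (s i • x) + 1 = d x
  descents : ∀ x ∈ O, ∀ i ∈ J, ∀ j ∈ J, i ≠ j → d (s i • x) + 1 = d x →
    d (s j • x) + 1 = d x → ¬ adj i j ∧ d (s i • s j • x) + 1 = d (s j • x)
  fixed : ∀ x ∈ O, ∀ i ∈ J, ∀ j ∈ J, d (s i • x) + 1 = d x → s j • x = x → adj i j →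
    d (s j • s i • x) + 1 = d (s i • x)

/-- `DescentPath s J d x₀ x w` says that `w` is a product of generators leading from `x₀` to `x`
and increasing the depth by one at each step. -/
inductive DescentPath {W X I : Type*} [Group W] [MulAction W X] (s : I → W) (J : Set I)
    (d : X → ℕ) (x₀ : X) : X → W → Prop
  | nil : DescentPath s J d x₀ x₀ 1
  | cons (x : X) (w : W) (i : I) : i ∈ J → d (s i • x) + 1 = d x →
      DescentPath s J d x₀ (s i • x) w → DescentPath s J d x₀ x (s i * w)

namespace DescentPath

variable {W X I : Type*} [Group W] [MulAction W X] {s : I → W} {J : Set I} {d : X → ℕ} {x₀ : X}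

theorem smul_eq (hs : ∀ i, s i * s i = 1) {x : X} {w : W} (hw : DescentPath s J d x₀ x w) :
    w • x₀ = x := by
  induction hw with
  | nil => simp
  | cons x w i hi hd hw ih => rw [mul_smul, ih, ← mul_smul, hs, one_smul]

theorem mem_closure {x : X} {w : W} (hw : DescentPath s J d x₀ x w) :
    w ∈ Subgroup.closure (s '' J) := by
  induction hw with
  | nil => exact one_mem _
  | cons x w i hi hd hw ih => exact mul_mem (Subgroup.subset_closure ⟨i, hi, rfl⟩) ih

end DescentPath

namespace IsMinusculeOrbit

variable {W X I : Type*} [Group W] [MulAction W X] {s : I → W} {adj : I → I → Prop}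
  {J K : Set I} {O : Set X} {d : X → ℕ} {x₀ : X}

theorem closure_le_stabilizer (h : IsMinusculeOrbit s adj J K O d x₀) :
    Subgroup.closure (s '' K) ≤ MulAction.stabilizer W x₀ := by
  rw [Subgroup.closure_le]
  rintro _ ⟨i, hi, rfl⟩
  exact (h.smul_base i (h.subset hi)).2 hi

theorem exists_path (h : IsMinusculeOrbit s adj J K O d x₀) {x : X} (hx : x ∈ O) :
    ∃ w, DescentPath s J d x₀ x w := by
  induction hn : d x generalizing x with
  | zero => exact ⟨1, h.eq_base x hx hn ▸ .nil⟩
  | succ n ih =>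
    obtain ⟨i, hi, hd⟩ := h.exists_descent x hx (by omega)
    obtain ⟨w, hw⟩ := ih (h.smul_mem x hx i hi) (by omega)
    exact ⟨_, .cons x w i hi hd hw⟩

theorem path_base (h : IsMinusculeOrbit s adj J K O d x₀)
    {w : W} (hw : DescentPath s J d x₀ x₀ w) : w = 1 := by
  cases hw with
  | nil => rfl
  | cons _ w i hi hd hw => have := h.depth_base; omega

/-- Two paths to the same point lie in the same left coset of the parabolic subgroup of type `K`,
and a generator fixing a point fixes the corresponding coset. -/
theorem path_unique_and_fixed (h : IsMinusculeOrbit s adj J K O d x₀)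
    (hs : ∀ i, s i * s i = 1)
    (hcomm : ∀ i j, ¬ adj i j → s i * s j = s j * s i)
    (hbraid : ∀ i j, adj i j → s i * s j * s i = s j * s i * s j) (n : ℕ) :
    (∀ x ∈ O, d x = n → ∀ w w', DescentPath s J d x₀ x w → DescentPath s J d x₀ x w' →
      w⁻¹ * w' ∈ Subgroup.closure (s '' K)) ∧
    (∀ x ∈ O, d x = n → ∀ j ∈ J, s j • x = x → ∀ w, DescentPath s J d x₀ x w →
      w⁻¹ * (s j * w) ∈ Subgroup.closure (s '' K)) := by
  have hsx (i : I) (x : X) : s i • s i • x = x := by rw [← mul_smul, hs, one_smul]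
  have hinv (i : I) : (s i)⁻¹ = s i := inv_eq_of_mul_eq_one_left (hs i)
  induction n using Nat.strong_induction_on with
  | _ n ih =>
  refine ⟨fun x hx hn w w' hw hw' => ?_, fun x hx hn j hj hfix w hw => ?_⟩
  · cases hw with
    | nil => rw [h.path_base hw']; simp
    | cons _ u i hi hd hu =>
    cases hw' with
    | nil => rw [h.depth_base] at hd; omega
    | cons _ u' j hj hd' hu' =>
    have hix := h.smul_mem x hx i hi
    have hjx := h.smul_mem x hx j hj
    by_cases hij : i = j
    · subst hij
      simpa [mul_assoc] using (ih (d (s i • x)) (by omega)).1 _ hix rfl _ _ hu hu'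
    obtain ⟨hc, hdd⟩ := h.descents x hx i hi j hj hij hd hd'
    have hc' := hcomm i j hc
    obtain ⟨v, hv⟩ := h.exists_path (h.smul_mem _ hjx i hi)
    have hji : s j • s i • x = s i • s j • x := by rw [← mul_smul, ← mul_smul, hc']
    have p₁ : DescentPath s J d x₀ (s i • x) (s j * v) :=
      .cons _ _ j hj (by rw [hji]; omega) (by rwa [hji])
    have p₂ : DescentPath s J d x₀ (s j • x) (s i * v) := .cons _ _ i hi hdd hv
    have m₁ := (ih _ (by omega)).1 _ hix rfl _ _ hu p₁
    have m₂ := (ih _ (by omega)).1 _ hjx rfl _ _ p₂ hu'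
    have := mul_mem m₁ m₂
    have e : (s i * u)⁻¹ * (s j * u') = u⁻¹ * (s j * v) * ((s i * v)⁻¹ * u') := by
      have : s i * s j = s j * (s i)⁻¹ := by rw [hinv, hc']
      simp only [mul_inv_rev, mul_assoc, mul_inv_cancel_left]
      rw [hinv i, ← mul_assoc (s i), hc', mul_assoc]
    rwa [e]
  · cases hw with
    | nil =>
      have : j ∈ K := (h.smul_base j hj).1 hfix
      simpa using Subgroup.subset_closure (Set.mem_image_of_mem s this)
    | cons _ u i hi hd hu =>
    have hix := h.smul_mem x hx i hi
    by_cases ha : adj i j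
    · have hdd := h.fixed x hx i hi j hj hd hfix ha
      have hb := hbraid i j ha
      have hk := h.smul_mem _ hix j hj
      obtain ⟨v, hv⟩ := h.exists_path hk
      have m₁ := (ih _ (by omega)).1 _ hix rfl _ _ hu (.cons _ _ j hj hdd hv)
      have hfix' : s i • s j • s i • x = s j • s i • x := by
        rw [← mul_smul, ← mul_smul, hb, mul_smul, hfix, mul_smul]
      have m₂ := (ih (d (s j • s i • x)) (by omega)).2 _ hk rfl i hi hfix' v hv
      have := mul_mem (mul_mem m₁ m₂) (inv_mem m₁)
      have e : (s i * u)⁻¹ * (s j * (s i * u)) =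
          u⁻¹ * (s j * v) * (v⁻¹ * (s i * v)) * (u⁻¹ * (s j * v))⁻¹ := by
        simp only [mul_inv_rev, mul_assoc, mul_inv_cancel_left, inv_inv, hinv]
        simp only [← mul_assoc] at hb ⊢
        rw [mul_assoc u⁻¹, mul_assoc u⁻¹, hb]
        simp only [mul_assoc]
      rwa [e]
    · have hc := hcomm i j ha
      have hfix' : s j • s i • x = s i • x := by
        rw [← mul_smul, ← hc, mul_smul, hfix]
      have := (ih (d (s i • x)) (by omega)).2 _ hix rfl j hj hfix' u hu
      have e : (s i * u)⁻¹ * (s j * (s i * u)) = u⁻¹ * (s j * u) := by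
        rw [mul_inv_rev, hinv, ← mul_assoc (s j), ← hc]
        simp only [mul_assoc]
        rw [← mul_assoc (s i) (s i), hs, one_mul]
      rwa [e]

theorem exists_path_mul (h : IsMinusculeOrbit s adj J K O d x₀)
    (hs : ∀ i, s i * s i = 1)
    (hcomm : ∀ i j, ¬ adj i j → s i * s j = s j * s i)
    (hbraid : ∀ i j, adj i j → s i * s j * s i = s j * s i * s j)
    {w : W} (hw : w ∈ Subgroup.closure (s '' J)) :
    ∃ x ∈ O, ∃ v, DescentPath s J d x₀ x v ∧ v⁻¹ * w ∈ Subgroup.closure (s '' K) := by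
  have hinv (i : I) : (s i)⁻¹ = s i := inv_eq_of_mul_eq_one_left (hs i)
  have key (i : I) (hi : i ∈ J) (w : W)
      (hw : ∃ x ∈ O, ∃ v, DescentPath s J d x₀ x v ∧ v⁻¹ * w ∈ Subgroup.closure (s '' K)) :
      ∃ x ∈ O, ∃ v, DescentPath s J d x₀ x v ∧
        v⁻¹ * (s i * w) ∈ Subgroup.closure (s '' K) := by
    obtain ⟨x, hx, v, hv, hm⟩ := hw
    have hix := h.smul_mem x hx i hi
    have hsx : s i • s i • x = x := by rw [← mul_smul, hs, one_smul]
    rcases h.depth_smul x hx i hi with hf | hu | hd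
    · refine ⟨x, hx, v, hv, ?_⟩
      have := mul_mem
        ((h.path_unique_and_fixed hs hcomm hbraid _).2 x hx rfl i hi hf v hv) hm
      simpa [mul_assoc] using this
    · refine ⟨_, hix, s i * v, .cons _ _ i hi (by rw [hsx, hu]) (by rwa [hsx]), ?_⟩
      simpa [mul_assoc] using hm
    · obtain ⟨v', hv'⟩ := h.exists_path hix
      refine ⟨_, hix, v', hv', ?_⟩
      have := mul_mem ((h.path_unique_and_fixed hs hcomm hbraid _).1 x hx rfl _ _
        (.cons x v' i hi hd hv') hv) hm
      simpa [mul_assoc, hinv] using this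
  induction hw using Subgroup.closure_induction_left with
  | one => exact ⟨x₀, h.base_mem, 1, .nil, by simp⟩
  | mul_left a ha w hw ih =>
    obtain ⟨i, hi, rfl⟩ := ha
    exact key i hi w ih
  | inv_mul_cancel a ha w hw ih =>
    obtain ⟨i, hi, rfl⟩ := ha
    rw [hinv]
    exact key i hi w ih

/-- The stabilizer of the base point is the standard parabolic subgroup of type `K`. -/
theorem mem_of_smul_eq (h : IsMinusculeOrbit s adj J K O d x₀)
    (hs : ∀ i, s i * s i = 1)
    (hcomm : ∀ i j, ¬ adj i j → s i * s j = s j * s i)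
    (hbraid : ∀ i j, adj i j → s i * s j * s i = s j * s i * s j)
    {w : W} (hw : w ∈ Subgroup.closure (s '' J)) (hfix : w • x₀ = x₀) :
    w ∈ Subgroup.closure (s '' K) := by
  obtain ⟨x, hx, v, hv, hm⟩ := h.exists_path_mul hs hcomm hbraid hw
  have e := hv.smul_eq hs
  have e' := h.closure_le_stabilizer hm
  rw [MulAction.mem_stabilizer_iff, mul_smul, hfix, inv_smul_eq_iff, e] at e'
  subst e'
  rw [h.path_base hv] at hm
  simpa using hm

/-- The orbit-stabilizer formula for a minuscule orbit. -/
theorem card_closure (h : IsMinusculeOrbit s adj J K O d x₀)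
    (hs : ∀ i, s i * s i = 1)
    (hcomm : ∀ i j, ¬ adj i j → s i * s j = s j * s i)
    (hbraid : ∀ i j, adj i j → s i * s j * s i = s j * s i * s j) :
    Nat.card (Subgroup.closure (s '' J)) = O.ncard * Nat.card (Subgroup.closure (s '' K)) := by
  have hle : Subgroup.closure (s '' K) ≤ Subgroup.closure (s '' J) :=
    Subgroup.closure_mono (Set.image_mono h.subset)
  have hst : MulAction.stabilizer (Subgroup.closure (s '' J)) x₀ =
      (Subgroup.closure (s '' K)).subgroupOf (Subgroup.closure (s '' J)) := by
    ext ⟨w, hw⟩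
    rw [MulAction.mem_stabilizer_iff, Subgroup.mem_subgroupOf]
    exact ⟨fun hf => h.mem_of_smul_eq hs hcomm hbraid hw hf, fun hu => h.closure_le_stabilizer hu⟩
  have horb : MulAction.orbit (Subgroup.closure (s '' J)) x₀ = O := by
    ext x
    constructor
    · rintro ⟨⟨w, hw⟩, rfl⟩
      obtain ⟨x, hx, v, hv, hm⟩ := h.exists_path_mul hs hcomm hbraid hw
      have hm' := h.closure_le_stabilizer hm
      rw [MulAction.mem_stabilizer_iff, mul_smul, inv_smul_eq_iff, hv.smul_eq hs] at hm'
      change w • x₀ ∈ O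
      rwa [hm']
    · intro hx
      obtain ⟨v, hv⟩ := h.exists_path hx
      exact ⟨⟨v, hv.mem_closure⟩, hv.smul_eq hs⟩
  have h₁ := MulAction.index_stabilizer (Subgroup.closure (s '' J)) x₀
  rw [hst, horb] at h₁
  have h₂ := Subgroup.card_mul_index
    ((Subgroup.closure (s '' K)).subgroupOf (Subgroup.closure (s '' J)))
  rw [h₁, Nat.card_congr (Subgroup.subgroupOfEquivOfLe hle).toEquiv, mul_comm] at h₂
  exact h₂.symm

end IsMinusculeOrbit

/-- The quadratic form on `𝔽₂⁶` (vectors are encoded by the binary digits of the elements of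
`Fin 64`) obtained by reducing half of the norm form of the `E₆` lattice modulo `2`. The binary
digits of the constant are the values of the form. -/
def quad (v : Fin 64) : Bool := Nat.testBit 17710698872139543862 v

/-- The reflection of `𝔽₂⁶` in the `i`-th simple root, which is the vector `2 ^ i`. -/
def modRefl (i : Fin 6) (v : Fin 64) : Fin 64 :=
  if quad (v ^^^ 2 ^ i.val) == quad v then v ^^^ 2 ^ i.val else v

theorem modRefl_modRefl (i : Fin 6) (v : Fin 64) : modRefl i (modRefl i v) = v := by
  revert i v; decide

/-- The reflection `modRefl i` as a permutation. -/
def modReflPerm (i : Fin 6) : Equiv.Perm (Fin 64) where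
  toFun := modRefl i
  invFun := modRefl i
  left_inv := modRefl_modRefl i
  right_inv := modRefl_modRefl i

set_option maxRecDepth 10000 in
theorem isLiftable_modReflPerm : CoxeterMatrix.E₆.IsLiftable modReflPerm := by
  intro i j
  ext1 v
  have h : ∀ i j : Fin 6, ∀ v : Fin 64,
      (fun v => modRefl i (modRefl j v))^[CoxeterMatrix.E₆.M i j] v = v := by decide
  have e := h i j v
  rwa [show (fun v => modRefl i (modRefl j v)) = ⇑(modReflPerm i * modReflPerm j) from rfl,
    Equiv.Perm.iterate_eq_pow] at e

/-- The simple reflections of `W(E₆)`. -/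
def simpleRefl (i : Fin 6) : WE6 := CoxeterMatrix.E₆.toCoxeterSystem.simple i

/-- The action of `W(E₆)` on the `E₆` lattice modulo `2`. -/
instance : MulAction WE6 (Fin 64) :=
  MulAction.compHom (Fin 64)
    (CoxeterMatrix.E₆.toCoxeterSystem.lift ⟨modReflPerm, isLiftable_modReflPerm⟩)

theorem simpleRefl_smul (i : Fin 6) (v : Fin 64) : simpleRefl i • v = modRefl i v := by
  change CoxeterMatrix.E₆.toCoxeterSystem.lift ⟨modReflPerm, isLiftable_modReflPerm⟩
    (simpleRefl i) v = _
  rw [simpleRefl, CoxeterSystem.lift_apply_simple]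
  rfl

theorem simpleRefl_mul_self (i : Fin 6) : simpleRefl i * simpleRefl i = 1 :=
  CoxeterSystem.simple_mul_simple_self _ i

/-- Adjacency in the `E₆` diagram. -/
def Adjacent (i j : Fin 6) : Prop := CoxeterMatrix.E₆ i j = 3

instance : DecidableRel Adjacent := fun i j => Nat.decEq (CoxeterMatrix.E₆ i j) 3

theorem eq_two_of_not_adjacent {i j : Fin 6} (hij : i ≠ j) (h : ¬ Adjacent i j) :
    CoxeterMatrix.E₆ i j = 2 := by
  have : ∀ i j : Fin 6, i ≠ j → ¬ Adjacent i j → (CoxeterMatrix.E₆ i j == 2) = true := by decide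
  exact eq_of_beq (this i j hij h)

theorem simpleRefl_comm (i j : Fin 6) (h : ¬ Adjacent i j) :
    simpleRefl i * simpleRefl j = simpleRefl j * simpleRefl i := by
  by_cases hij : i = j
  · rw [hij]
  have e : (simpleRefl i * simpleRefl j) ^ CoxeterMatrix.E₆ i j = 1 :=
    CoxeterSystem.simple_mul_simple_pow _ i j
  rw [eq_two_of_not_adjacent hij h, pow_two] at e
  have := eq_inv_of_mul_eq_one_left e
  rwa [mul_inv_rev, inv_eq_of_mul_eq_one_left (simpleRefl_mul_self i),
    inv_eq_of_mul_eq_one_left (simpleRefl_mul_self j)] at this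

theorem simpleRefl_braid (i j : Fin 6) (h : Adjacent i j) :
    simpleRefl i * simpleRefl j * simpleRefl i =
      simpleRefl j * simpleRefl i * simpleRefl j := by
  have e : (simpleRefl i * simpleRefl j) ^ CoxeterMatrix.E₆ i j = 1 :=
    CoxeterSystem.simple_mul_simple_pow _ i j
  rw [show CoxeterMatrix.E₆ i j = 3 from h] at e
  have : (simpleRefl i * simpleRefl j * simpleRefl i) *
      (simpleRefl j * simpleRefl i * simpleRefl j) = 1 := by
    rw [← e]; simp only [pow_succ, pow_zero, one_mul, mul_assoc]
  have := eq_inv_of_mul_eq_one_left this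
  simpa only [mul_inv_rev, inv_eq_of_mul_eq_one_left (simpleRefl_mul_self i),
    inv_eq_of_mul_eq_one_left (simpleRefl_mul_self j), mul_assoc] using this

/-- The depth of a point of an orbit given as a list of levels. -/
def depthOf (levels : List (List (Fin 64))) (v : Fin 64) : ℕ := levels.findIdx (·.contains v)

/-- The decidable form of `IsMinusculeOrbit` for the simple reflections numbered from `k` on. -/
def LevelsCheck (k : ℕ) (levels : List (List (Fin 64))) (x₀ : Fin 64) : Prop :=
  x₀ ∈ levels.flatten ∧ depthOf levels x₀ = 0 ∧
  (∀ i : Fin 6, k ≤ i → (modRefl i x₀ = x₀ ↔ k + 1 ≤ i.val)) ∧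
  ∀ x ∈ levels.flatten, (depthOf levels x = 0 → x = x₀) ∧
    (depthOf levels x ≠ 0 →
      ∃ i : Fin 6, k ≤ i.val ∧ depthOf levels (modRefl i x) + 1 = depthOf levels x) ∧
    ∀ i : Fin 6, k ≤ i.val → modRefl i x ∈ levels.flatten ∧
      (modRefl i x = x ∨ depthOf levels (modRefl i x) = depthOf levels x + 1 ∨
        depthOf levels (modRefl i x) + 1 = depthOf levels x) ∧
      (depthOf levels (modRefl i x) + 1 = depthOf levels x → ∀ j : Fin 6, k ≤ j.val →
        (i ≠ j → depthOf levels (modRefl j x) + 1 = depthOf levels x → ¬ Adjacent i j ∧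
          depthOf levels (modRefl i (modRefl j x)) + 1 = depthOf levels (modRefl j x)) ∧
        (modRefl j x = x → Adjacent i j →
          depthOf levels (modRefl j (modRefl i x)) + 1 = depthOf levels (modRefl i x)))

set_option synthInstance.maxHeartbeats 200000 in
set_option synthInstance.maxSize 1000 in
instance (k : ℕ) (levels : List (List (Fin 64))) (x₀ : Fin 64) :
    Decidable (LevelsCheck k levels x₀) := by
  unfold LevelsCheck; infer_instance

theorem LevelsCheck.isMinusculeOrbit {k : ℕ} {levels : List (List (Fin 64))} {x₀ : Fin 64}
    (h : LevelsCheck k levels x₀) :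
    IsMinusculeOrbit simpleRefl Adjacent {i | k ≤ i.val} {i | k + 1 ≤ i.val}
      {x | x ∈ levels.flatten} (depthOf levels) x₀ := by
  obtain ⟨h₁, h₂, h₃, h₄⟩ := h
  constructor
  case subset => exact fun i (hi : k + 1 ≤ i.val) => (Nat.le_succ k).trans hi
  case base_mem => exact h₁
  case depth_base => exact h₂
  case eq_base => exact fun x hx => (h₄ x hx).1
  all_goals simp only [simpleRefl_smul]
  · exact fun x hx i hi => ((h₄ x hx).2.2 i hi).1
  · exact h₃
  · exact fun x hx => (h₄ x hx).2.1
  · exact fun x hx i hi => ((h₄ x hx).2.2 i hi).2.1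
  · exact fun x hx i hi j hj hij hd hd' => (((h₄ x hx).2.2 i hi).2.2 hd j hj).1 hij hd'
  · exact fun x hx i hi j hj hd => (((h₄ x hx).2.2 i hi).2.2 hd j hj).2

/-- The subgroup generated by the simple reflections numbered from `k` on. -/
def tailSubgroup (k : ℕ) : Subgroup WE6 := Subgroup.closure (simpleRefl '' {i | k ≤ i.val})

theorem LevelsCheck.mem_tailSubgroup_succ {k : ℕ} {levels : List (List (Fin 64))} {x₀ : Fin 64}
    (h : LevelsCheck k levels x₀) {w : WE6} (hw : w ∈ tailSubgroup k) (hx : w • x₀ = x₀) :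
    w ∈ tailSubgroup (k + 1) :=
  h.isMinusculeOrbit.mem_of_smul_eq simpleRefl_mul_self simpleRefl_comm simpleRefl_braid hw hx

theorem LevelsCheck.card_tailSubgroup {k : ℕ} {levels : List (List (Fin 64))} {x₀ : Fin 64}
    (h : LevelsCheck k levels x₀) (hn : levels.flatten.Nodup) :
    Nat.card (tailSubgroup k) = levels.flatten.length * Nat.card (tailSubgroup (k + 1)) := by
  have e : {x | x ∈ levels.flatten}.ncard = levels.flatten.length := by
    rw [← List.toFinset_card_of_nodup hn, ← Set.ncard_coe_finset, List.coe_toFinset]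
  rw [← e]
  exact h.isMinusculeOrbit.card_closure simpleRefl_mul_self simpleRefl_comm simpleRefl_braid

theorem tailSubgroup_zero : tailSubgroup 0 = ⊤ := by
  have : simpleRefl '' {i | 0 ≤ i.val} = Set.range simpleRefl := by
    simp
  rw [tailSubgroup, this]
  exact CoxeterSystem.subgroup_closure_range_simple _

theorem tailSubgroup_six : tailSubgroup 6 = ⊥ := by
  have : simpleRefl '' {i | 6 ≤ i.val} = ∅ := by
    ext w; simp only [Set.mem_image, Set.mem_empty_iff_false, iff_false]
    rintro ⟨i, hi, -⟩
    exact absurd i.isLt (not_lt.2 hi)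
  rw [tailSubgroup, this, Subgroup.closure_empty]

section Levels

set_option maxRecDepth 100000

theorem levelsCheck_zero : LevelsCheck 0 [[6], [7], [3], [11], [9, 27], [25, 59], [17, 57],
    [21, 49], [20, 53, 33], [52, 37], [36, 45], [44, 47], [46, 40], [42], [34], [50], [18]] 6 := by
  decide

theorem levelsCheck_one : LevelsCheck 1 [[47], [45], [37], [33, 53], [49, 21], [57, 17], [59, 25],
    [27, 9], [11], [3], [7]] 47 := by
  decide

theorem levelsCheck_two : LevelsCheck 2 [[7], [3], [11], [27], [59]] 7 := by decide

theorem levelsCheck_three : LevelsCheck 3 [[3], [11], [27], [59]] 3 := by decide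

theorem levelsCheck_four : LevelsCheck 4 [[9], [25], [57]] 9 := by decide

theorem levelsCheck_five : LevelsCheck 5 [[17], [49]] 17 := by decide

theorem card_WE6 : Nat.card WE6 = 51840 := by
  have h : Nat.card (tailSubgroup 0) = 51840 := by
    rw [levelsCheck_zero.card_tailSubgroup (by decide),
      levelsCheck_one.card_tailSubgroup (by decide), levelsCheck_two.card_tailSubgroup (by decide),
      levelsCheck_three.card_tailSubgroup (by decide),
      levelsCheck_four.card_tailSubgroup (by decide),
      levelsCheck_five.card_tailSubgroup (by decide), tailSubgroup_six, Subgroup.card_bot]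
    rfl
  rwa [tailSubgroup_zero, Subgroup.card_top] at h

end Levels

/-- The action of `W(E₆)` on its lattice modulo `2` is faithful. -/
instance : FaithfulSMul WE6 (Fin 64) := by
  refine ⟨fun {w₁ w₂} hw => ?_⟩
  suffices h : ∀ w : WE6, (∀ v : Fin 64, w • v = v) → w = 1 from
    inv_mul_eq_one.1 (h _ fun v => by rw [mul_smul, inv_smul_eq_iff, hw])
  intro w hw
  have h₀ : w ∈ tailSubgroup 0 := by rw [tailSubgroup_zero]; trivial
  have h₁ := levelsCheck_zero.mem_tailSubgroup_succ h₀ (hw _)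
  have h₂ := levelsCheck_one.mem_tailSubgroup_succ h₁ (hw _)
  have h₃ := levelsCheck_two.mem_tailSubgroup_succ h₂ (hw _)
  have h₄ := levelsCheck_three.mem_tailSubgroup_succ h₃ (hw _)
  have h₅ := levelsCheck_four.mem_tailSubgroup_succ h₄ (hw _)
  have h₆ := levelsCheck_five.mem_tailSubgroup_succ h₅ (hw _)
  rwa [tailSubgroup_six, Subgroup.mem_bot] at h₆

theorem quad_modRefl (i : Fin 6) (v : Fin 64) : quad (modRefl i v) = quad v := by
  revert i v; decide

theorem modRefl_xor (i : Fin 6) (v w : Fin 64) :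
    modRefl i (v ^^^ w) = modRefl i v ^^^ modRefl i w := by
  revert i v w; decide +kernel

/-- Induction on the elements of `W(E₆)` by left multiplication with simple reflections. -/
theorem WE6.induction_on_simpleRefl {p : WE6 → Prop} (one : p 1)
    (mul : ∀ (i : Fin 6) (w : WE6), p w → p (simpleRefl i * w)) (w : WE6) : p w :=
  CoxeterSystem.simple_induction_left (cs := CoxeterMatrix.E₆.toCoxeterSystem) w one
    fun w i h => mul i w h

theorem quad_smul (w : WE6) (v : Fin 64) : quad (w • v) = quad v := by
  induction w using WE6.induction_on_simpleRefl with
  | one => rw [one_smul]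
  | mul i w ih => rw [mul_smul, simpleRefl_smul, quad_modRefl, ih]

theorem smul_xor (w : WE6) (u v : Fin 64) : w • (u ^^^ v) = w • u ^^^ w • v := by
  induction w using WE6.induction_on_simpleRefl with
  | one => simp only [one_smul]
  | mul i w ih => simp only [mul_smul, simpleRefl_smul, ih, modRefl_xor]

/-- The product of the simple reflections with the given numbers. -/
def wordProd (l : List (Fin 6)) : WE6 := (l.map simpleRefl).prod

theorem wordProd_append (l l' : List (Fin 6)) :
    wordProd (l ++ l') = wordProd l * wordProd l' := by
  simp [wordProd]

theorem wordProd_smul (l : List (Fin 6)) (v : Fin 64) : wordProd l • v = l.foldr modRefl v := by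
  induction l with
  | nil => exact one_smul _ v
  | cons i l ih =>
    rw [← List.singleton_append, wordProd_append, mul_smul, ih, List.foldr_append]
    simp [wordProd, simpleRefl_smul]

theorem wordProd_eq_of_forall {l l' : List (Fin 6)}
    (h : ∀ v : Fin 64, l.foldr modRefl v = l'.foldr modRefl v) : wordProd l = wordProd l' :=
  FaithfulSMul.eq_of_smul_eq_smul fun v : Fin 64 => by rw [wordProd_smul, wordProd_smul, h]

/-- The Coxeter element of the parabolic subgroup of type `A₄`; it has order `5`. -/
def fiveCycle : WE6 := wordProd [0, 2, 3, 4]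

theorem fiveCycle_pow_five : fiveCycle ^ 5 = 1 := by
  have : wordProd ([0, 2, 3, 4] ++ [0, 2, 3, 4] ++ [0, 2, 3, 4] ++ [0, 2, 3, 4] ++ [0, 2, 3, 4]) =
      wordProd [] := wordProd_eq_of_forall (by decide +kernel)
  rw [wordProd_append, wordProd_append, wordProd_append, wordProd_append] at this
  rw [pow_succ, pow_succ, pow_succ, pow_succ, pow_one]
  exact this

theorem exists_conj_fiveCycle_eq_sq : ∃ n : WE6, n * fiveCycle * n⁻¹ = fiveCycle ^ 2 := by
  have : wordProd ([0, 3, 2] ++ [0, 2, 3, 4]) =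
      wordProd ([0, 2, 3, 4] ++ [0, 2, 3, 4] ++ [0, 3, 2]) :=
    wordProd_eq_of_forall (by decide +kernel)
  rw [wordProd_append, wordProd_append, wordProd_append] at this
  exact ⟨wordProd [0, 3, 2], by rw [mul_inv_eq_iff_eq_mul, fiveCycle, this, pow_two]⟩

/-- The action of `fiveCycle`, in computable form. -/
def fiveAct (v : Fin 64) : Fin 64 := [0, 2, 3, 4].foldr modRefl v

/-- The action of the inverse of `fiveCycle`, in computable form. -/
def fiveInvAct (v : Fin 64) : Fin 64 := [4, 3, 2, 0].foldr modRefl v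

theorem fiveCycle_smul (v : Fin 64) : fiveCycle • v = fiveAct v := wordProd_smul _ v

theorem fiveCycle_inv_smul (v : Fin 64) : fiveCycle⁻¹ • v = fiveInvAct v := by
  rw [inv_smul_eq_iff, fiveCycle_smul]
  have : ∀ v : Fin 64, v = fiveAct (fiveInvAct v) := by decide +kernel
  exact this v

/-- The partial map of `𝔽₂⁶` to itself whose graph is `M ++ L` is compatible with the quadratic
form, as far as pairs with a member in `M` and values at single points of `M` are concerned. -/
def compatible (M L : List (Fin 64 × Fin 64)) : Bool :=
  M.all fun p => quad p.1 == quad p.2 &&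
    (M ++ L).all fun q => quad (p.1 ^^^ q.1) == quad (p.2 ^^^ q.2)

theorem compatible_of_smul {y : WE6} {M L : List (Fin 64 × Fin 64)}
    (h : ∀ p ∈ M ++ L, y • p.1 = p.2) : compatible M L = true := by
  simp only [compatible, List.all_eq_true, Bool.and_eq_true, beq_iff_eq]
  refine fun p hp => ?_
  have hp' := h p (List.mem_append_left _ hp)
  refine ⟨by rw [← hp', quad_smul], fun q hq => ?_⟩
  rw [← hp', ← h q hq, ← smul_xor, quad_smul]

/-- If `y u = z` and `y (x u) = c`, where `x` is `fiveCycle`, then these are further pairs in the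
graph of an involution `y` such that `x y` has order `3`. -/
def impliedPairs (u z c : Fin 64) : List (Fin 64 × Fin 64) :=
  [(fiveAct u, c), (c, fiveAct u), (fiveAct c, fiveInvAct z), (fiveInvAct z, fiveAct c)]

theorem smul_of_mem_impliedPairs {y : WE6} (hy : y * y = 1) (hxy : (fiveCycle * y) ^ 3 = 1)
    {u z c : Fin 64} (hz : y • u = z) (hc : y • fiveAct u = c) :
    ∀ p ∈ impliedPairs u z c, y • p.1 = p.2 := by
  have hyy (v : Fin 64) : y • y • v = v := by rw [← mul_smul, hy, one_smul]
  have hrel : y * fiveCycle * y = fiveCycle⁻¹ * y * fiveCycle⁻¹ := by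
    have hy' : y⁻¹ = y := inv_eq_of_mul_eq_one_left hy
    have : (y * fiveCycle * y) * (fiveCycle * y * fiveCycle) = 1 := by
      have e : (fiveCycle * y) * ((fiveCycle * y) * (fiveCycle * y)) = 1 := by
        simpa [pow_succ, mul_assoc] using hxy
      have := congrArg (fun g => fiveCycle⁻¹ * g * fiveCycle) e
      simpa [mul_assoc] using this
    rw [eq_inv_of_mul_eq_one_left this]
    simp [mul_assoc, hy']
  have h₃ : y • fiveAct c = fiveInvAct z := by
    rw [← hc, ← hz, ← fiveCycle_smul, ← fiveCycle_smul, ← fiveCycle_inv_smul]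
    simp only [← mul_smul]
    rw [← mul_assoc, ← mul_assoc, hrel]
    simp [mul_assoc]
  have h₂ : y • c = fiveAct u := by rw [← hc, hyy]
  have h₄ : y • fiveInvAct z = fiveAct c := by rw [← h₃, hyy]
  simp only [impliedPairs, List.mem_cons, List.not_mem_nil, or_false]
  rintro p (rfl | rfl | rfl | rfl) <;> assumption

/-- An involution in the parabolic subgroup of type `A₄`. -/
def involutionIn : List (Fin 6) := [0, 3]

/-- An involution outside the parabolic subgroup of type `A₄`. -/
def involutionOut : List (Fin 6) := [4, 3, 5, 4]

/-- The word for the conjugate of `wordProd t` by the `k`-th power of `fiveCycle`. -/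
def conjWord (k : ℕ) (t : List (Fin 6)) : List (Fin 6) :=
  (List.replicate k [0, 2, 3, 4]).flatten ++ t ++ (List.replicate k [4, 3, 2, 0]).flatten

theorem wordProd_flatten_replicate (k : ℕ) (l : List (Fin 6)) :
    wordProd (List.replicate k l).flatten = wordProd l ^ k := by
  induction k with
  | zero => simp [wordProd]
  | succ k ih => rw [List.replicate_succ, List.flatten_cons, wordProd_append, ih, pow_succ']

theorem wordProd_conjWord (k : ℕ) (t : List (Fin 6)) :
    wordProd (conjWord k t) = fiveCycle ^ k * wordProd t * (fiveCycle ^ k)⁻¹ := by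
  have h : wordProd [4, 3, 2, 0] = fiveCycle⁻¹ :=
    FaithfulSMul.eq_of_smul_eq_smul fun v : Fin 64 => by
      rw [wordProd_smul, fiveCycle_inv_smul]; rfl
  rw [conjWord, wordProd_append, wordProd_append, wordProd_flatten_replicate,
    wordProd_flatten_replicate, h, inv_pow, fiveCycle]

/-- The conjugates of the two involutions by powers of `fiveCycle`. -/
def solutionWords : List (List (Fin 6)) :=
  (List.range 5).map (conjWord · involutionIn) ++ (List.range 5).map (conjWord · involutionOut)

/-- Exhaustive search, by depth `n`, for the partial maps extending the one with graph `L` to the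
next `n` points in the `fiveCycle`-orbit of `u`: all of them come from `solutionWords`. -/
def search : ℕ → Fin 64 → Fin 64 → List (Fin 64 × Fin 64) → Bool
  | 0, _, _, L => solutionWords.any fun l => L.all fun p => l.foldr modRefl p.1 == p.2
  | n + 1, u, z, L => (List.finRange 64).all fun c =>
    !compatible (impliedPairs u z c) L || search n (fiveAct u) c (impliedPairs u z c ++ L)

theorem exists_of_search {y : WE6} (hy : y * y = 1) (hxy : (fiveCycle * y) ^ 3 = 1) {n : ℕ}
    {u z : Fin 64} {L : List (Fin 64 × Fin 64)} (h : search n u z L = true) (hz : y • u = z)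
    (hL : ∀ p ∈ L, y • p.1 = p.2) :
    ∃ l ∈ solutionWords, (∀ p ∈ L, wordProd l • p.1 = y • p.1) ∧
      ∀ k < n, wordProd l • fiveAct^[k + 1] u = y • fiveAct^[k + 1] u := by
  induction n generalizing u z L with
  | zero =>
    simp only [search, List.any_eq_true, List.all_eq_true, beq_iff_eq] at h
    obtain ⟨l, hl, h⟩ := h
    exact ⟨l, hl, fun p hp => by rw [wordProd_smul, h p hp, hL p hp], by simp⟩
  | succ n ih =>
    simp only [search, List.all_eq_true] at h
    have hM := smul_of_mem_impliedPairs hy hxy hz rfl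
    have hML : ∀ p ∈ impliedPairs u z (y • fiveAct u) ++ L, y • p.1 = p.2 := fun p hp =>
      (List.mem_append.1 hp).elim (hM p) (hL p)
    have h' := h (y • fiveAct u) (List.mem_finRange _)
    rw [compatible_of_smul hML, Bool.not_true, Bool.false_or] at h'
    obtain ⟨l, hl, h₁, h₂⟩ := ih h' rfl hML
    refine ⟨l, hl, fun p hp => h₁ p (List.mem_append_right _ hp), fun k hk => ?_⟩
    cases k with
    | zero => exact h₁ (fiveAct u, y • fiveAct u) (by simp [impliedPairs])
    | succ k => exact h₂ k (by omega)

theorem smul_fixed_vector {y : WE6} (hy : y * y = 1) (hxy : (fiveCycle * y) ^ 3 = 1) :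
    y • (41 : Fin 64) = 41 := by
  have key : ∀ c d : Fin 64, c = 41 ∨ compatible (impliedPairs 41 c c) [] = false ∨
      compatible (impliedPairs (fiveAct c) (fiveInvAct c) d) (impliedPairs 41 c c) = false := by
    decide +kernel
  have hM := smul_of_mem_impliedPairs hy hxy (u := 41) rfl rfl
  have e : fiveAct 41 = 41 := by decide
  rw [e] at hM
  have hN := smul_of_mem_impliedPairs hy hxy (u := fiveAct (y • 41)) (z := fiveInvAct (y • 41))
    (hM (_, _) (List.mem_of_getElem? (i := 2) rfl)) rfl
  rcases key (y • 41) (y • fiveAct (fiveAct (y • 41))) with h | h | h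
  · exact h
  · rw [compatible_of_smul (by simpa using hM)] at h; cases h
  · rw [compatible_of_smul fun p hp => (List.mem_append.1 hp).elim (hN p) (hM p)] at h; cases h

theorem search_eq_true : ∀ z : Fin 64, compatible [(3, z), (z, 3)] [(41, 41)] = false ∨
    search 4 3 z [(3, z), (z, 3), (41, 41)] = true := by
  decide +kernel

/-- The vectors `41` and `x ^ k • 3`, `k < 5`, span `𝔽₂⁶`. -/
theorem exists_xor_eq (v : Fin 64) : ∃ l : List (Fin 64),
    (∀ u ∈ l, u = 41 ∨ ∃ k < 5, u = fiveAct^[k] 3) ∧ l.foldr (· ^^^ ·) 0 = v := by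
  have key : ∀ v : Fin 64, ∃ l ∈ (41 :: (List.range 5).map (fiveAct^[·] 3)).sublists,
      l.foldr (· ^^^ ·) 0 = v := by decide +kernel
  obtain ⟨l, hl, hv⟩ := key v
  refine ⟨l, fun u hu => ?_, hv⟩
  have := (List.mem_sublists.1 hl).subset hu
  rw [List.mem_cons, List.mem_map] at this
  simpa only [List.mem_range, eq_comm] using this

theorem exists_of_involution {y : WE6} (hy : y * y = 1) (hxy : (fiveCycle * y) ^ 3 = 1) :
    ∃ l ∈ solutionWords, y = wordProd l := by
  have h41 := smul_fixed_vector hy hxy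
  have h3 : y • y • (3 : Fin 64) = 3 := by rw [← mul_smul, hy, one_smul]
  have hL : ∀ p ∈ [((3 : Fin 64), y • (3 : Fin 64)), (y • 3, 3), (41, 41)], y • p.1 = p.2 := by
    simp [h41, h3]
  obtain ⟨l, hl, h₁, h₂⟩ := exists_of_search hy hxy
    ((search_eq_true (y • 3)).resolve_left fun h => by
      rw [compatible_of_smul (by simpa only [List.cons_append, List.nil_append] using hL)] at h
      cases h) rfl hL
  refine ⟨l, hl, FaithfulSMul.eq_of_smul_eq_smul fun v : Fin 64 => ?_⟩
  have hgen : ∀ u : Fin 64, (u = 41 ∨ ∃ k < 5, u = fiveAct^[k] 3) → y • u = wordProd l • u := by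
    rintro u (rfl | ⟨k, hk, rfl⟩)
    · exact (h₁ (41, 41) (by simp)).symm
    · cases k with
      | zero => exact (h₁ (3, y • 3) (by simp)).symm
      | succ k => exact (h₂ k (by omega)).symm
  obtain ⟨m, hm, rfl⟩ := exists_xor_eq v
  induction m with
  | nil =>
    have h0 (w : WE6) : w • (0 : Fin 64) = 0 := by
      have := smul_xor w 0 0
      rwa [show (0 : Fin 64) ^^^ 0 = 0 from rfl,
        show w • (0 : Fin 64) ^^^ w • 0 = 0 by generalize w • (0 : Fin 64) = a; revert a; decide]
        at this
    rw [List.foldr_nil, h0, h0]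
  | cons u m ih =>
    rw [List.foldr_cons, smul_xor, smul_xor, hgen u (hm u (by simp)),
      ih fun u hu => hm u (by simp [hu])]

theorem exists_conjWord {y : WE6} (hy : y * y = 1) (hxy : (fiveCycle * y) ^ 3 = 1) :
    ∃ k : ℕ, y = fiveCycle ^ k * wordProd involutionIn * (fiveCycle ^ k)⁻¹ ∨
      y = fiveCycle ^ k * wordProd involutionOut * (fiveCycle ^ k)⁻¹ := by
  obtain ⟨l, hl, rfl⟩ := exists_of_involution hy hxy
  rw [solutionWords, List.mem_append, List.mem_map, List.mem_map] at hl
  obtain ⟨k, -, rfl⟩ | ⟨k, -, rfl⟩ := hl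
  · exact ⟨k, .inl (wordProd_conjWord k _)⟩
  · exact ⟨k, .inr (wordProd_conjWord k _)⟩

theorem fiveCycle_ne_one : fiveCycle ≠ 1 := fun h => by
  have := fiveCycle_smul 3
  rw [h, one_smul] at this
  revert this; decide

instance : Finite WE6 := Nat.finite_of_card_ne_zero (by rw [card_WE6]; decide)

open scoped Pointwise in
/-- The elements of order `5` of `W(E₆)` form a single conjugacy class. -/
theorem isConj_fiveCycle {g : WE6} (hg : g ^ 5 = 1) (hg₁ : g ≠ 1) : IsConj g fiveCycle := by
  have : Fact (Nat.Prime 5) := ⟨by norm_num⟩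
  have hcard {h : WE6} (h₅ : h ^ 5 = 1) (h₁ : h ≠ 1) : Nat.card (Subgroup.zpowers h) =
      5 ^ (Nat.card WE6).factorization 5 := by
    rw [Nat.card_zpowers, orderOf_eq_prime h₅ h₁, card_WE6,
      show 51840 = 5 * 10368 from rfl, Nat.factorization_mul (by decide) (by decide),
      Finsupp.add_apply, Nat.Prime.factorization_self (by norm_num),
      Nat.factorization_eq_zero_of_not_dvd (by decide), add_zero, pow_one]
  obtain ⟨w, hw⟩ := MulAction.exists_smul_eq WE6 (Sylow.ofCard _ (hcard hg hg₁))
    (Sylow.ofCard _ (hcard fiveCycle_pow_five fiveCycle_ne_one))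
  have hmem : w * g * w⁻¹ ∈ Subgroup.zpowers fiveCycle := by
    have := congrArg (fun P : Sylow 5 WE6 => (P : Subgroup WE6)) hw
    change MulAut.conj w • Subgroup.zpowers g = Subgroup.zpowers fiveCycle at this
    rw [← this]
    exact Subgroup.smul_mem_pointwise_smul g (MulAut.conj w) _ (Subgroup.mem_zpowers g)
  have hconj : IsConj g (w * g * w⁻¹) := isConj_iff.2 ⟨w, rfl⟩
  have h₂ : IsConj fiveCycle (fiveCycle ^ 2) := isConj_iff.2 exists_conj_fiveCycle_eq_sq
  have h₄ : IsConj fiveCycle (fiveCycle ^ 4) := h₂.trans (by simpa [← pow_mul] using h₂.pow 2)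
  have h₃ : IsConj fiveCycle (fiveCycle ^ 3) := h₂.trans (by
    have := h₄.pow 2
    rwa [← pow_mul, show 4 * 2 = 5 + 3 from rfl, pow_add, fiveCycle_pow_five, one_mul] at this)
  obtain ⟨n, hn⟩ := mem_powers_iff_mem_zpowers.2 hmem
  dsimp only at hn
  rw [← pow_mod_orderOf, orderOf_eq_prime fiveCycle_pow_five fiveCycle_ne_one] at hn
  rw [← hn] at hconj
  have hlt : n % 5 < 5 := Nat.mod_lt _ (by decide)
  generalize n % 5 = k at hconj hlt
  interval_cases k
  · rw [pow_zero, isConj_one_left] at hconj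
    exact absurd hconj hg₁
  · rwa [pow_one] at hconj
  · exact hconj.trans h₂.symm
  · exact hconj.trans h₃.symm
  · exact hconj.trans h₄.symm

/-- The even permutation `(0 1 2 3 4)`. -/
def altFiveCycle : alternatingGroup (Fin 6) := 
  ⟨c[0, 1, 2, 3, 4], Equiv.Perm.mem_alternatingGroup.2 (by decide +kernel)⟩

/-- The even permutation `(0 1) (2 3)`. -/
def altInvolutionFixing : alternatingGroup (Fin 6) := 
  ⟨c[0, 1] * c[2, 3], Equiv.Perm.mem_alternatingGroup.2 (by decide +kernel)⟩

/-- An even involution moving `5`. -/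
def altInvolutionMoving : alternatingGroup (Fin 6) := 
  ⟨c[2, 4] * c[3, 5], Equiv.Perm.mem_alternatingGroup.2 (by decide +kernel)⟩

theorem closure_altGenerators : Subgroup.closure
    {altFiveCycle, altInvolutionFixing, altInvolutionMoving} = ⊤ := by
  set H := Subgroup.closure {altFiveCycle, altInvolutionFixing, altInvolutionMoving}
  have hc : altFiveCycle ∈ H := Subgroup.subset_closure (by simp)
  have hd : altInvolutionFixing ∈ H := Subgroup.subset_closure (by simp)
  have he : altInvolutionMoving ∈ H := Subgroup.subset_closure (by simp)
  set K := H.map (alternatingGroup (Fin 6)).subtype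
  have hK {g} (hg : g ∈ H) : (g : Equiv.Perm (Fin 6)) ∈ K := ⟨g, hg, rfl⟩
  have key : ∀ a b : Fin 6, a ≠ b →
      (∃ j < 5, (altFiveCycle ^ j).1 5 = a ∧ (altFiveCycle ^ j).1 0 = b) ∨
      ∃ i < 5, ∃ j < 5, (altFiveCycle ^ i * altInvolutionMoving * altFiveCycle ^ j).1 5 = a ∧
        (altFiveCycle ^ i * altInvolutionMoving * altFiveCycle ^ j).1 0 = b := by
    decide +kernel
  have key' (a b : Fin 6) (hab : a ≠ b) : ∃ g : K, g.1 5 = a ∧ g.1 0 = b := by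
    obtain ⟨j, -, h⟩ | ⟨i, -, j, -, h⟩ := key a b hab
    · exact ⟨⟨_, hK (pow_mem hc j)⟩, h⟩
    · exact ⟨⟨_, hK (mul_mem (mul_mem (pow_mem hc i) he) (pow_mem hc j))⟩, h⟩
  have : MulAction.IsMultiplyPretransitive K (Fin 6) 2 := by
    rw [MulAction.is_two_pretransitive_iff]
    intro a b a' b' h h'
    obtain ⟨g, rfl, rfl⟩ := key' a b h
    obtain ⟨g', rfl, rfl⟩ := key' a' b' h'
    exact ⟨g' * g⁻¹, by simp [Subgroup.smul_def], by simp [Subgroup.smul_def]⟩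
  have hprim : MulAction.IsPreprimitive K (Fin 6) :=
    MulAction.isPreprimitive_of_is_two_pretransitive inferInstance
  have h3 : (altFiveCycle * altInvolutionFixing).1.IsThreeCycle := by
    rw [← card_support_eq_three_iff]; decide +kernel
  have := Equiv.Perm.alternatingGroup_le_of_isPreprimitive_of_isThreeCycle_mem hprim h3
    (hK (mul_mem hc hd))
  refine eq_top_iff.2 fun g _ => ?_
  obtain ⟨g', hg', e⟩ := this g.2
  rwa [← Subtype.ext e]

/-- A subgroup of `W(E₆)` isomorphic to `𝔄₆`. -/
def standardAlt : Subgroup WE6 :=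
  Subgroup.closure {fiveCycle, wordProd involutionIn, wordProd involutionOut}

theorem closure_conj_pow {G : Type*} [Group G] (x y z : G) (i j : ℕ) :
    Subgroup.closure {x, x ^ i * y * (x ^ i)⁻¹, x ^ j * z * (x ^ j)⁻¹} =
      Subgroup.closure {x, y, z} := by
  have hle (y z : G) {a b : G} (ha : a ∈ Subgroup.zpowers x) (hb : b ∈ Subgroup.zpowers x) :
      Subgroup.closure {x, a * y * a⁻¹, b * z * b⁻¹} ≤ Subgroup.closure {x, y, z} := by
    have hx : x ∈ Subgroup.closure {x, y, z} := Subgroup.subset_closure (by simp)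
    have hconj {a g : G} (ha : a ∈ Subgroup.zpowers x) (hg : g ∈ Subgroup.closure {x, y, z}) :
        a * g * a⁻¹ ∈ Subgroup.closure {x, y, z} := by
      have ha' := Subgroup.zpowers_le.2 hx ha
      exact mul_mem (mul_mem ha' hg) (inv_mem ha')
    rw [Subgroup.closure_le]
    rintro g (rfl | rfl | rfl)
    · exact hx
    · exact hconj ha (Subgroup.subset_closure (by simp))
    · exact hconj hb (Subgroup.subset_closure (by simp))
  have hpow (k : ℕ) : x ^ k ∈ Subgroup.zpowers x := Subgroup.npow_mem_zpowers x k
  refine le_antisymm (hle y z (hpow i) (hpow j)) ?_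
  simpa [mul_assoc] using hle (x ^ i * y * (x ^ i)⁻¹) (x ^ j * z * (x ^ j)⁻¹)
    (inv_mem (hpow i)) (inv_mem (hpow j))

/-- Every subgroup of `W(E₆)` isomorphic to `𝔄₆` is conjugate to `standardAlt`. -/
theorem exists_map_conj_range_eq_standardAlt {f : alternatingGroup (Fin 6) →* WE6}
    (hf : Function.Injective f) :
    ∃ w : WE6, Subgroup.map (MulAut.conj w).toMonoidHom f.range = standardAlt := by
  obtain ⟨w, hw⟩ := isConj_iff.1 (isConj_fiveCycle (g := f altFiveCycle)
    (by rw [← map_pow, show altFiveCycle ^ 5 = 1 by decide +kernel, map_one])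
    (by rw [Ne, map_eq_one_iff f hf]; decide +kernel))
  refine ⟨w, ?_⟩
  set g := (MulAut.conj w).toMonoidHom.comp f
  have hg : Function.Injective g := (MulAut.conj w).injective.comp hf
  have hgc : g altFiveCycle = fiveCycle := hw
  have hinv {d : alternatingGroup (Fin 6)} (hd : d * d = 1) (hcd : (altFiveCycle * d) ^ 3 = 1) :=
    exists_conjWord (y := g d) (by rw [← map_mul, hd, map_one])
      (by rw [← hgc, ← map_mul, ← map_pow, hcd, map_one])
  have hne {t : WE6} {i j : ℕ}
      (hi : g altInvolutionFixing = fiveCycle ^ i * t * (fiveCycle ^ i)⁻¹)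
      (hj : g altInvolutionMoving = fiveCycle ^ j * t * (fiveCycle ^ j)⁻¹) : False := by
    have e : altInvolutionMoving = altFiveCycle ^ j * (altFiveCycle ^ i)⁻¹ *
        altInvolutionFixing * altFiveCycle ^ i * (altFiveCycle ^ j)⁻¹ :=
      hg (by simp only [map_mul, map_pow, map_inv, hgc, hi, hj]; group)
    have hc : altFiveCycle ∈ MulAction.stabilizer (alternatingGroup (Fin 6)) (5 : Fin 6) := by
      rw [MulAction.mem_stabilizer_iff]; decide +kernel
    have hd : altInvolutionFixing ∈
        MulAction.stabilizer (alternatingGroup (Fin 6)) (5 : Fin 6) := by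
      rw [MulAction.mem_stabilizer_iff]; decide +kernel
    have he : altInvolutionMoving ∈
        MulAction.stabilizer (alternatingGroup (Fin 6)) (5 : Fin 6) := by
      rw [e]
      exact mul_mem (mul_mem (mul_mem (mul_mem (pow_mem hc j) (inv_mem (pow_mem hc i))) hd)
        (pow_mem hc i)) (inv_mem (pow_mem hc j))
    rw [MulAction.mem_stabilizer_iff] at he
    revert he; decide +kernel
  obtain ⟨i, hi⟩ := hinv (d := altInvolutionFixing) (by decide +kernel) (by decide +kernel)
  obtain ⟨j, hj⟩ := hinv (d := altInvolutionMoving) (by decide +kernel) (by decide +kernel)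
  have hrange : Subgroup.map (MulAut.conj w).toMonoidHom f.range =
      Subgroup.closure {fiveCycle, g altInvolutionFixing, g altInvolutionMoving} := by
    rw [← hgc, MonoidHom.map_range, MonoidHom.range_eq_map, ← closure_altGenerators,
      MonoidHom.map_closure, Set.image_insert_eq, Set.image_pair]
  rw [hrange, standardAlt]
  rcases hi with hi | hi <;> rcases hj with hj | hj
  · exact (hne hi hj).elim
  · rw [hi, hj, closure_conj_pow]
  · rw [hi, hj, closure_conj_pow, Set.pair_comm]
  · exact (hne hi hj).elim

/-- Any two subgroups of the Weyl group `W(E₆)` isomorphic to the alternating group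
`𝔄₆` are conjugate in `W(E₆)`. -/
theorem stmt_14 (G₁ G₂ : Subgroup WE6)
    (h₁ : Nonempty (G₁ ≃* alternatingGroup (Fin 6)))
    (h₂ : Nonempty (G₂ ≃* alternatingGroup (Fin 6))) :
    ∃ w : WE6, Subgroup.map (MulAut.conj w).toMonoidHom G₁ = G₂ := by
  have key (G : Subgroup WE6) (h : Nonempty (G ≃* alternatingGroup (Fin 6))) :
      ∃ w : WE6, Subgroup.map (MulAut.conj w).toMonoidHom G = standardAlt := by
    obtain ⟨e⟩ := h
    have := exists_map_conj_range_eq_standardAlt (f := G.subtype.comp e.symm.toMonoidHom)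
      (G.subtype_injective.comp e.symm.injective)
    rwa [MonoidHom.range_comp, MonoidHom.range_eq_top.2 e.symm.surjective,
      ← MonoidHom.range_eq_map, Subgroup.range_subtype] at this
  obtain ⟨w₁, hw₁⟩ := key G₁ h₁
  obtain ⟨w₂, hw₂⟩ := key G₂ h₂
  refine ⟨w₂⁻¹ * w₁, ?_⟩
  have hinj : Function.Injective (Subgroup.map (MulAut.conj w₂).toMonoidHom) :=
    Subgroup.map_injective (MulAut.conj w₂).injective
  refine hinj ?_
  rw [hw₂, ← hw₁, Subgroup.map_map]
  congr 1
  ext g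
  simp [mul_assoc]
end

section
/- The group of 4×4 matrices M over the field 𝔽₂ with two elements satisfying MᵀM = E (the orthogonal group O₄(𝔽₂) with respect to the standard symmetric bilinear form), is isomorphic to ℤ/2ℤ × 𝔖₄, the direct product of a cyclic group of order 2 and the symmetric group of degree 4. In particular, it has order 48; it consists of the 24 permutation matrices and the 24 matrices obtained from permutation matrices by adding the all-ones matrix. -/
open Matrix

/-- The orthogonal group `O₄(𝔽₂)`: the monoid (in fact group) of `4 × 4` matrices `M`
over `𝔽₂` with `Mᵀ * M = 1`. -/
def O4F2 : Submonoid (Matrix (Fin 4) (Fin 4) (ZMod 2)) where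
  carrier := {M | Mᵀ * M = 1}
  one_mem' := by simp
  mul_mem' := by
    intro a b ha hb
    simp only [Set.mem_setOf_eq] at ha hb ⊢
    rw [Matrix.transpose_mul, Matrix.mul_assoc, ← Matrix.mul_assoc aᵀ, ha,
      Matrix.one_mul, hb]

/-- The vector `c • (1, 1, 1, 1) + eᵢ` over `𝔽₂`. -/
def shiftedBasisVec (c : ZMod 2) (i : Fin 4) : Fin 4 → ZMod 2 :=
  fun k => c + if k = i then 1 else 0

theorem shiftedBasisVec_dotProduct (c d : ZMod 2) (i j : Fin 4) :
    shiftedBasisVec c i ⬝ᵥ shiftedBasisVec d j = shiftedBasisVec (c + d) i j := by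
  revert c d i j
  decide

theorem exists_eq_shiftedBasisVec (v : Fin 4 → ZMod 2) (hv : v ⬝ᵥ v = 1) :
    ∃ c i, v = shiftedBasisVec c i := by
  revert v
  decide

theorem shiftedBasisVec_injective (c d : ZMod 2) (i j : Fin 4)
    (h : shiftedBasisVec c i = shiftedBasisVec d j) : c = d ∧ i = j := by
  revert c d i j
  decide

/-- The matrix of the permutation `σ`, plus `c` times the all-ones matrix. -/
def shiftedPermMatrix (c : ZMod 2) (σ : Equiv.Perm (Fin 4)) : Matrix (Fin 4) (Fin 4) (ZMod 2) :=
  (Matrix.of fun j => shiftedBasisVec c (σ j))ᵀ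

theorem shiftedPermMatrix_mem (c : ZMod 2) (σ : Equiv.Perm (Fin 4)) :
    shiftedPermMatrix c σ ∈ O4F2 := by
  change (shiftedPermMatrix c σ)ᵀ * shiftedPermMatrix c σ = 1
  ext j k
  change shiftedBasisVec c (σ j) ⬝ᵥ shiftedBasisVec c (σ k) = _
  rw [shiftedBasisVec_dotProduct, CharTwo.add_self_eq_zero]
  simp [shiftedBasisVec, Matrix.one_apply, eq_comm]

theorem shiftedPermMatrix_mul (c d : ZMod 2) (σ τ : Equiv.Perm (Fin 4)) :
    shiftedPermMatrix (c + d) (σ * τ) = shiftedPermMatrix c σ * shiftedPermMatrix d τ := by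
  ext j k
  have hrow : shiftedPermMatrix c σ j = shiftedBasisVec c (σ⁻¹ j) := by
    ext l
    simp [shiftedPermMatrix, shiftedBasisVec, Equiv.eq_symm_apply, eq_comm (a := j)]
  change _ = shiftedPermMatrix c σ j ⬝ᵥ shiftedBasisVec d (τ k)
  rw [hrow, shiftedBasisVec_dotProduct]
  simp [shiftedPermMatrix, shiftedBasisVec, Equiv.eq_symm_apply, eq_comm (a := j)]

/-- The homomorphism `ℤ/2ℤ × 𝔖₄ → O₄(𝔽₂)` sending `(c, σ)` to the matrix of `σ` plus `c` times
the all-ones matrix. -/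
def shiftedPermHom : Multiplicative (ZMod 2) × Equiv.Perm (Fin 4) →* O4F2 where
  toFun p := ⟨shiftedPermMatrix p.1.toAdd p.2, shiftedPermMatrix_mem _ _⟩
  map_one' := by
    ext j k
    simp [shiftedPermMatrix, shiftedBasisVec, Matrix.one_apply]
  map_mul' p q := Subtype.ext (shiftedPermMatrix_mul _ _ _ _)

theorem shiftedPermHom_injective : Function.Injective shiftedPermHom := by
  rintro ⟨c, σ⟩ ⟨d, τ⟩ h
  have hcol (j : Fin 4) := shiftedBasisVec_injective c.toAdd d.toAdd (σ j) (τ j)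
    (congrArg (fun M : O4F2 => M.1ᵀ j) h)
  exact Prod.ext (hcol 0).1 (Equiv.ext fun j => (hcol j).2)

theorem shiftedPermHom_surjective : Function.Surjective shiftedPermHom := by
  rintro ⟨M, hM⟩
  have hdot (j k : Fin 4) : Mᵀ j ⬝ᵥ Mᵀ k = if j = k then 1 else 0 :=
    (congrFun₂ hM j k).trans Matrix.one_apply
  choose c i hci using fun j => exists_eq_shiftedBasisVec (Mᵀ j) (by simp [hdot])
  have hpair (j k : Fin 4) (hjk : j ≠ k) : c j + c k + (if i k = i j then 1 else 0) = 0 := by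
    have := hdot j k
    rwa [hci, hci, shiftedBasisVec_dotProduct, if_neg hjk] at this
  have hone_ne : (1 : ZMod 2) ≠ 0 := one_ne_zero
  have heq_iff (j k : Fin 4) (hjk : j ≠ k) : c j = c k ↔ i k ≠ i j := by
    have := hpair j k hjk
    split_ifs at this with hi
    · refine iff_of_false (fun hc => ?_) (not_not_intro hi)
      rw [hc, CharTwo.add_self_eq_zero, zero_add] at this
      exact hone_ne this
    · exact iff_of_true (CharTwo.add_eq_zero.mp (by simpa using this)) hi
  have htwo (a b d : ZMod 2) (hab : a ≠ b) : d = a ∨ d = b := by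
    revert a b d
    decide
  have hthird (j k : Fin 4) : ∃ l, l ≠ j ∧ l ≠ k := by
    revert j k
    decide
  have hconst (j k : Fin 4) : c j = c k := by
    by_contra hc
    have hjk : j ≠ k := fun h => hc (congrArg c h)
    obtain ⟨l, hlj, hlk⟩ := hthird j k
    have h₁ := heq_iff j k hjk
    have h₂ := heq_iff l j hlj
    have h₃ := heq_iff l k hlk
    rcases htwo _ _ (c l) hc with h | h <;> grind
  have hinj : Function.Injective i := fun j k hi => by
    by_contra hjk
    exact (heq_iff j k hjk).mp (hconst j k) hi.symm
  refine ⟨(.ofAdd (c 0), .ofBijective i (Finite.injective_iff_bijective.mp hinj)),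
    Subtype.ext (Matrix.transpose_injective (funext fun j => ?_))⟩
  rw [hci, hconst j 0]
  rfl

/-- The group of `4 × 4` matrices `M` over `𝔽₂` with `Mᵀ * M = 1` is isomorphic to
`ℤ/2ℤ × 𝔖₄`. -/
theorem stmt_16 : Nonempty (O4F2 ≃* Multiplicative (ZMod 2) × Equiv.Perm (Fin 4)) := by
  exact ⟨(MulEquiv.ofBijective shiftedPermHom
    ⟨shiftedPermHom_injective, shiftedPermHom_surjective⟩).symm⟩
end

section
/- Let F be a field of characteristic 2 containing an element ω with ω² + ω + 1 = 0 and ω ≠ 1 (a non-trivial cube root of unity). Then there exist an invertible 4×4 matrix A over F and a nonzero scalar c ∈ F such that substituting the linear forms determined by A into the Fermat cubic polynomial X³ + Y³ + Z³ + T³ yields c·(x²t + y²z + z²y + t²x). In other words, over such a field the cubic surface x²t + y²z + z²y + t²x = 0 is projectively equivalent to the Fermat cubic surface x³ + y³ + z³ + t³ = 0; an explicit such collineation is [x : y : z : t] ↦ [x + y : ωx + ω²y : z + t : ωz + ω²t] followed by a diagonal rescaling of coordinates. -/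
/-- In characteristic `2`, a root `w` of `w² + w + 1` turns a sum of two cubes
into `x²t + t²x`. -/
theorem add_cubes_eq_of_two_eq_zero {R : Type*} [CommRing R] {w : R} (h2 : (2 : R) = 0)
    (hw : w ^ 2 + w + 1 = 0) (x t : R) :
    (w * x + w ^ 2 * t) ^ 3 + (x + w ^ 2 * t) ^ 3 = x ^ 2 * t + t ^ 2 * x := by
  linear_combination
    ((w - 1) * x ^ 3 + (w ^ 2 - w + 1) * x ^ 2 * t + (w ^ 3 - w + 1) * x * t ^ 2) * hw +
    (x ^ 3 + (w ^ 4 + w ^ 2 - 1) * x ^ 2 * t + (w ^ 5 + w ^ 4 - 1) * x * t ^ 2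
      + w ^ 6 * t ^ 3) * h2

open MvPolynomial in
/-- Over a field of characteristic `2` containing a non-trivial cube root of unity `ω`,
the cubic surface `x²t + y²z + z²y + t²x = 0` is projectively equivalent to the Fermat
cubic surface `x³ + y³ + z³ + t³ = 0`: there is an invertible linear change of variables
`A` and a nonzero scalar `c` transforming the Fermat cubic polynomial into
`c • (x²t + y²z + z²y + t²x)`. -/
theorem stmt_17 {F : Type*} [Field F] [CharP F 2] (ω : F)
    (hω : ω ^ 2 + ω + 1 = 0) (hω1 : ω ≠ 1) :
    ∃ A : Matrix (Fin 4) (Fin 4) F, IsUnit A.det ∧ ∃ c : F, c ≠ 0 ∧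
      aeval (fun i : Fin 4 => ∑ j : Fin 4, C (A i j) * X j)
          (X 0 ^ 3 + X 1 ^ 3 + X 2 ^ 3 + X 3 ^ 3 : MvPolynomial (Fin 4) F) =
        C c * (X 0 ^ 2 * X 3 + X 1 ^ 2 * X 2 + X 2 ^ 2 * X 1 + X 3 ^ 2 * X 0) := by
  have hω0 : ω ≠ 0 := by
    rintro rfl
    simp at hω
  refine ⟨!![ω, 0, 0, ω ^ 2; 1, 0, 0, ω ^ 2; 0, ω, ω ^ 2, 0; 0, 1, ω ^ 2, 0], ?_,
    1, one_ne_zero, ?_⟩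
  · have hdet : Matrix.det
        !![ω, 0, 0, ω ^ 2; 1, 0, 0, ω ^ 2; 0, ω, ω ^ 2, 0; 0, 1, ω ^ 2, 0] =
        (ω ^ 2 * (ω - 1)) ^ 2 := by
      simp [Matrix.det_succ_row_zero, Fin.sum_univ_succ, Fin.succAbove]
      ring
    rw [hdet, isUnit_iff_ne_zero]
    exact pow_ne_zero 2 (mul_ne_zero (pow_ne_zero 2 hω0) (sub_ne_zero.mpr hω1))
  · have hC2 : (2 : MvPolynomial (Fin 4) F) = 0 := CharTwo.two_eq_zero
    have hCω : (C ω : MvPolynomial (Fin 4) F) ^ 2 + C ω + 1 = 0 := by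
      simpa using congrArg (C (σ := Fin 4)) hω
    have hxt := add_cubes_eq_of_two_eq_zero hC2 hCω (X 0) (X 3)
    have hyz := add_cubes_eq_of_two_eq_zero hC2 hCω (X 1) (X 2)
    simp [Fin.sum_univ_four]
    linear_combination hxt + hyz
end
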